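/- The Poincaré series of the algebras of GL_n × SL₂-invariant polynomial functions on M_n ⊗ K² for n = 2 and n = 3 satisfy P(C^#_{2,2}; t) = 1 / (1−t⁴)² and P(C^#_{3,2}; t) = (1 + 3t⁸ + t¹⁰ + 3t¹² + t²⁰) / ((1−t⁴)³(1−t⁶)³(1−t⁸)). -/

import Mathlib

open MvPolynomial Matrix

noncomputable section

/-- Index type for the entries of a pair of generic `n × n` matrices:
`Sum.inl (i,j)` indexes the `(i,j)` entry of `x`, `Sum.inr (i,j)` that of `y`. -/
abbrev MatVar (n : ℕ) := (Fin n × Fin n) ⊕ (Fin n × Fin n)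

/-- The substitution sending the variables to the entries of the pair `(A, B)`. -/
def pairSub {K : Type*} [CommSemiring K] {n : ℕ} (A B : Matrix (Fin n) (Fin n) K) :
    MatVar n → K
  | Sum.inl ij => A ij.1 ij.2
  | Sum.inr ij => B ij.1 ij.2

/-- A polynomial function on pairs of `n × n` matrices is `GLₙ`-invariant (for the action
by simultaneous conjugation). -/
def IsMatInvariant {K : Type*} [Field K] {n : ℕ} (f : MvPolynomial (MatVar n) K) : Prop :=
  ∀ (a : GL (Fin n) K) (A B : Matrix (Fin n) (Fin n) K),
    MvPolynomial.eval
        (pairSub ((a : Matrix (Fin n) (Fin n) K) * A * ((a⁻¹ : GL (Fin n) K) : Matrix (Fin n) (Fin n) K))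
          ((a : Matrix (Fin n) (Fin n) K) * B * ((a⁻¹ : GL (Fin n) K) : Matrix (Fin n) (Fin n) K))) f =
      MvPolynomial.eval (pairSub A B) f


/-- A polynomial function on pairs of `n × n` matrices is invariant under
`GLₙ × SL₂`, where `GLₙ` acts by simultaneous conjugation and `SL₂` acts by its
standard representation on the pair: `(x, y) ↦ (αx + γy, βx + δy)` for
`(α β; γ δ) ∈ SL₂`. -/
def IsSharpInvariant {K : Type*} [Field K] {n : ℕ} (f : MvPolynomial (MatVar n) K) : Prop :=
  IsMatInvariant f ∧
    ∀ (g : Matrix.SpecialLinearGroup (Fin 2) K) (A B : Matrix (Fin n) (Fin n) K),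
      MvPolynomial.eval
          (pairSub ((g : Matrix (Fin 2) (Fin 2) K) 0 0 • A + (g : Matrix (Fin 2) (Fin 2) K) 1 0 • B)
            ((g : Matrix (Fin 2) (Fin 2) K) 0 1 • A + (g : Matrix (Fin 2) (Fin 2) K) 1 1 • B)) f =
        MvPolynomial.eval (pairSub A B) f

/-- The homogeneous component of total degree `k` of the algebra `C^#_{n,2}` of
`GLₙ × SL₂`-invariants. -/
def sharpComponent (K : Type*) [Field K] (n k : ℕ) : Set (MvPolynomial (MatVar n) K) :=
  {f | IsSharpInvariant f ∧ f.IsHomogeneous k}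

/-- `dim_K (C^#_{n,2})_k`. -/
def sharpDim (K : Type*) [Field K] (n k : ℕ) : ℕ :=
  Set.finrank K (sharpComponent K n k)

/-- The Poincaré series `P(C^#_{n,2}; t)`. -/
def sharpPS (K : Type*) [Field K] (n : ℕ) : PowerSeries ℚ :=
  PowerSeries.mk fun k => (sharpDim K n k : ℚ)

/-- The power series variable `t`. -/
def pu : PowerSeries ℚ := PowerSeries.X

def wt (n : ℕ) : MatVar n → ℤ × ℤ
  | Sum.inl _ => (1, 0)
  | Sum.inr _ => (0, 1)

section sl2
variable {K V : Type*} [Field K] [CharZero K] [AddCommGroup V] [Module K V]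

lemma sl2_comm (E F H : V →ₗ[K] V) (h1 : ∀ v, E (F v) - F (E v) = H v)
    (h2 : ∀ v, H (F v) = F (H v) - (2 : K) • F v) (N : ℕ) : ∀ (w : V) (μ : K), H w = μ • w →
      (F ^ (N + 1)) (E w) = E ((F ^ (N + 1)) w) - (((N : K) + 1) * (μ - N)) • (F ^ N) w := by
  induction N with
  | zero =>
    intro w μ hw
    have := h1 w
    rw [hw] at this
    simp only [zero_add, pow_one, pow_zero, Module.End.one_apply, Nat.cast_zero, one_mul, sub_zero]
    rw [← this]; abel
  | succ N ih =>
    intro w μ hw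
    have h := h1 w
    rw [hw] at h
    have e : F (E w) = E (F w) - μ • w := by rw [← h]; abel
    have e2 : ∀ k (v : V), (F ^ (k + 1)) v = (F ^ k) (F v) := fun k v => by
      rw [pow_succ, Module.End.mul_apply]
    rw [e2 (N + 1) (E w), e, map_sub, ih (F w) (μ - 2) (by rw [h2, hw, map_smul, sub_smul]),
      ← e2, ← e2, map_smul]
    push_cast
    module

lemma sl2_surj (E F H : V →ₗ[K] V) (h1 : ∀ v, E (F v) - F (E v) = H v)
    (h2 : ∀ v, H (F v) = F (H v) - (2 : K) • F v) (W W' : Submodule K V) (lam : ℕ)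
    (hl : 0 < lam) (hH : ∀ w ∈ W, H w = (-(lam : K)) • w) (hE : ∀ w ∈ W, E w ∈ W')
    (hF : ∀ w ∈ W', F w ∈ W) (N : ℕ) :
    ∀ w ∈ W, (F ^ N) w = 0 → ∃ v ∈ W', F v = w := by
  induction N with
  | zero => intro w _ h; exact ⟨0, W'.zero_mem, by simpa using h.symm⟩
  | succ N ih =>
    intro w hw h
    have h3 := sl2_comm E F H h1 h2 N w _ (hH w hw)
    rw [h, map_zero, zero_sub] at h3
    set c : K := ((N : K) + 1) * (-(lam : K) - N) with hc
    have hc0 : c ≠ 0 := by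
      have : c = -(((N + 1) * (lam + N) : ℕ) : K) := by rw [hc]; push_cast; ring
      rw [this, neg_ne_zero, Nat.cast_ne_zero]; positivity
    obtain ⟨v, hv, hv'⟩ := ih (F (E w) + c • w)
      (W.add_mem (hF _ (hE _ hw)) (W.smul_mem _ hw)) (by
        rw [map_add, ← Module.End.mul_apply, ← pow_succ, h3, map_smul]; abel)
    refine ⟨c⁻¹ • (v - E w), W'.smul_mem _ (W'.sub_mem hv (hE _ hw)), ?_⟩
    rw [map_smul, map_sub, hv', add_sub_cancel_left, smul_smul, inv_mul_cancel₀ hc0, one_smul]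

lemma sl2_ker (E F H : V →ₗ[K] V) (h1 : ∀ v, E (F v) - F (E v) = H v)
    (h2 : ∀ v, H (F v) = F (H v) - (2 : K) • F v) (v : V) (hv : H v = 0) (hE : E v = 0)
    (N : ℕ) : (F ^ (N + 1)) v = 0 → F v = 0 := by
  induction N with
  | zero => simp
  | succ N ih =>
    intro h
    apply ih
    have h3 := sl2_comm E F H h1 h2 (N + 1) v 0 (by simpa using hv)
    rw [h, hE, map_zero, map_zero, zero_sub, eq_comm, neg_eq_zero, smul_eq_zero] at h3
    rcases h3 with h3 | h3
    · exfalso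
      have : (((N + 2) * (N + 1) : ℕ) : K) = 0 := by push_cast at h3 ⊢; linear_combination -h3
      rw [Nat.cast_eq_zero] at this
      simp at this
    · exact h3
end sl2

section ops
variable (K : Type*) [Field K] (n : ℕ)

/-- `x ↦ y` -/
def opF : Derivation K (MvPolynomial (MatVar n) K) (MvPolynomial (MatVar n) K) :=
  ∑ i : Fin n × Fin n, (X (Sum.inr i) : MvPolynomial (MatVar n) K) • pderiv (Sum.inl i)
/-- `y ↦ x` -/
def opE : Derivation K (MvPolynomial (MatVar n) K) (MvPolynomial (MatVar n) K) :=
  ∑ i : Fin n × Fin n, (X (Sum.inl i) : MvPolynomial (MatVar n) K) • pderiv (Sum.inr i)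
def opH : Derivation K (MvPolynomial (MatVar n) K) (MvPolynomial (MatVar n) K) :=
  ⁅opE K n, opF K n⁆

variable {K n}

lemma dersum_apply {ι σ : Type*} (s : Finset ι) (a : ι → MvPolynomial σ K)
    (D : ι → Derivation K (MvPolynomial σ K) (MvPolynomial σ K)) (f : MvPolynomial σ K) :
    (∑ i ∈ s, a i • D i) f = ∑ i ∈ s, a i * D i f := by
  induction s using Finset.cons_induction with
  | empty => simp
  | cons b s ha ih => rw [Finset.sum_cons, Finset.sum_cons, Derivation.add_apply, ih]; simp
lemma opF_apply (f) : opF K n f = ∑ i : Fin n × Fin n, X (Sum.inr i) * pderiv (Sum.inl i) f :=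
  dersum_apply _ _ _ _
lemma opE_apply (f) : opE K n f = ∑ i : Fin n × Fin n, X (Sum.inl i) * pderiv (Sum.inr i) f :=
  dersum_apply _ _ _ _

@[simp] lemma opF_inl (i) : opF K n (X (Sum.inl i)) = X (Sum.inr i) := by
  rw [opF_apply]; simp [pderiv_X, Pi.single_apply]
@[simp] lemma opF_inr (i) : opF K n (X (Sum.inr i)) = 0 := by
  rw [opF_apply]; simp [pderiv_X, Pi.single_apply]
@[simp] lemma opE_inr (i) : opE K n (X (Sum.inr i)) = X (Sum.inl i) := by
  rw [opE_apply]; simp [pderiv_X, Pi.single_apply]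
@[simp] lemma opE_inl (i) : opE K n (X (Sum.inl i)) = 0 := by
  rw [opE_apply]; simp [pderiv_X, Pi.single_apply]
@[simp] lemma opH_inl (i) : opH K n (X (Sum.inl i)) = X (Sum.inl i) := by
  simp [opH, Derivation.commutator_apply]
@[simp] lemma opH_inr (i) : opH K n (X (Sum.inr i)) = - X (Sum.inr i) := by
  simp [opH, Derivation.commutator_apply]

lemma opHF (f) : opH K n (opF K n f) = opF K n (opH K n f) - (2 : K) • opF K n f := by
  have : ⁅opH K n, opF K n⁆ = - ((2 : K) • opF K n) := by
    apply derivation_ext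
    rintro (i | i) <;> simp [Derivation.commutator_apply, two_smul] <;> ring
  have := congrArg (fun D => D f) this
  simp only [Derivation.commutator_apply, Derivation.neg_apply, Derivation.smul_apply] at this
  rw [sub_eq_iff_eq_add] at this
  rw [this]; abel
lemma opHE (f) : opH K n (opE K n f) = opE K n (opH K n f) + (2 : K) • opE K n f := by
  have : ⁅opH K n, opE K n⁆ = ((2 : K) • opE K n) := by
    apply derivation_ext
    rintro (i | i) <;> simp [Derivation.commutator_apply, two_smul] <;> ring
  have := congrArg (fun D => D f) this
  simp only [Derivation.commutator_apply, Derivation.neg_apply, Derivation.smul_apply] at this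
  rw [sub_eq_iff_eq_add] at this
  rw [this]; abel

lemma opF_wt {f : MvPolynomial (MatVar n) K} {p q : ℤ} (hf : f.IsWeightedHomogeneous (wt n) (p, q)) :
    (opF K n f).IsWeightedHomogeneous (wt n) (p - 1, q + 1) := by
  rw [opF_apply]
  refine IsWeightedHomogeneous.sum _ _ _ fun i _ => ?_
  have h := (isWeightedHomogeneous_X K (wt n) (Sum.inr i)).mul
    (hf.pderiv (i := Sum.inl i) (n' := (p - 1, q)) (by simp [wt]))
  convert h using 1
  simp [wt, add_comm]
lemma opE_wt {f : MvPolynomial (MatVar n) K} {p q : ℤ} (hf : f.IsWeightedHomogeneous (wt n) (p, q)) :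
    (opE K n f).IsWeightedHomogeneous (wt n) (p + 1, q - 1) := by
  rw [opE_apply]
  refine IsWeightedHomogeneous.sum _ _ _ fun i _ => ?_
  have h := (isWeightedHomogeneous_X K (wt n) (Sum.inl i)).mul
    (hf.pderiv (i := Sum.inr i) (n' := (p, q - 1)) (by simp [wt]))
  convert h using 1
  simp [wt, add_comm]

lemma weight_wt (d : MatVar n →₀ ℕ) : Finsupp.weight (wt n) d =
    (∑ i, (d (Sum.inl i) : ℤ), ∑ i, (d (Sum.inr i) : ℤ)) := by
  rw [Finsupp.weight_apply, Finsupp.sum_fintype _ _ (by simp), Fintype.sum_sum_type]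
  ext <;> simp [wt, Prod.fst_sum, Prod.snd_sum]

lemma wt_neg {f : MvPolynomial (MatVar n) K} {p q : ℤ} (hf : f.IsWeightedHomogeneous (wt n) (p, q))
    (h : p < 0 ∨ q < 0) : f = 0 := by
  ext d
  rw [coeff_zero]
  refine hf.coeff_eq_zero d ?_
  rw [weight_wt]
  intro he
  simp only [Prod.mk.injEq] at he
  have h1 : 0 ≤ ∑ i, (d (Sum.inl i) : ℤ) := Finset.sum_nonneg fun _ _ => by positivity
  have h2 : 0 ≤ ∑ i, (d (Sum.inr i) : ℤ) := Finset.sum_nonneg fun _ _ => by positivity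
  omega

lemma opH_apply (f) : opH K n f = ∑ i : Fin n × Fin n, X (Sum.inl i) * pderiv (Sum.inl i) f
    - ∑ i : Fin n × Fin n, X (Sum.inr i) * pderiv (Sum.inr i) f := by
  have : opH K n = ∑ i : Fin n × Fin n, (X (Sum.inl i) : MvPolynomial (MatVar n) K) • pderiv (Sum.inl i)
    - ∑ i : Fin n × Fin n, (X (Sum.inr i) : MvPolynomial (MatVar n) K) • pderiv (Sum.inr i) := by
    apply derivation_ext
    rintro (i | i) <;> rw [Derivation.sub_apply, dersum_apply, dersum_apply] <;>
      simp [pderiv_X, Pi.single_apply]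
  rw [this, Derivation.sub_apply, dersum_apply, dersum_apply]

lemma opH_wt {f : MvPolynomial (MatVar n) K} {p q : ℤ} (hf : f.IsWeightedHomogeneous (wt n) (p, q)) :
    opH K n f = ((p : K) - q) • f := by
  refine IsWeightedHomogeneous.induction_on (motive := fun f _ => opH K n f = ((p : K) - q) • f)
    (by simp) ?_ ?_ hf
  · intro f g _ _ h1 h2
    rw [map_add, h1, h2, smul_add]
  · intro d r h
    rw [weight_wt] at h
    simp only [Prod.mk.injEq] at h
    rw [opH_apply]
    simp only [X_mul_pderiv_monomial]
    rw [← Finset.sum_smul, ← Finset.sum_smul, ← h.1, ← h.2, sub_smul]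
    push_cast
    simp only [← Nat.cast_sum, Nat.cast_smul_eq_nsmul]
end ops

section line
variable {K : Type*} [Field K] {n : ℕ}

lemma line_deriv {σ : Type*} (D : Derivation K (MvPolynomial σ K) (MvPolynomial σ K))
    (l : σ → Polynomial K) (h : ∀ i, Polynomial.derivative (l i) = aeval l (D (X i)))
    (f : MvPolynomial σ K) : Polynomial.derivative (aeval l f) = aeval l (D f) := by
  induction f using MvPolynomial.induction_on with
  | C a => simp
  | add f g hf hg => simp [hf, hg]
  | mul_X f i hf => simp [hf, h]; ring

lemma line_eval {σ : Type*} (f : MvPolynomial σ K) (s : K) (l : σ → Polynomial K) :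
    Polynomial.eval s (aeval l f) = eval (fun i => Polynomial.eval s (l i)) f := by
  induction f using MvPolynomial.induction_on with
  | C a => simp
  | add f g hf hg => simp [hf, hg]
  | mul_X f i hf => simp [hf]

def lineF (A B : Matrix (Fin n) (Fin n) K) : MatVar n → Polynomial K
  | Sum.inl i => Polynomial.C (A i.1 i.2) + Polynomial.X * Polynomial.C (B i.1 i.2)
  | Sum.inr i => Polynomial.C (B i.1 i.2)
def lineE (A B : Matrix (Fin n) (Fin n) K) : MatVar n → Polynomial K
  | Sum.inl i => Polynomial.C (A i.1 i.2)
  | Sum.inr i => Polynomial.C (B i.1 i.2) + Polynomial.X * Polynomial.C (A i.1 i.2)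

lemma lineF_eval (A B : Matrix (Fin n) (Fin n) K) (f : MvPolynomial (MatVar n) K) (s : K) :
    Polynomial.eval s (aeval (lineF A B) f) = eval (pairSub (A + s • B) B) f := by
  rw [line_eval]
  congr 2
  funext i
  rcases i with i | i <;> simp [lineF, pairSub, -Polynomial.X_mul_C]
lemma lineE_eval (A B : Matrix (Fin n) (Fin n) K) (f : MvPolynomial (MatVar n) K) (s : K) :
    Polynomial.eval s (aeval (lineE A B) f) = eval (pairSub A (B + s • A)) f := by
  rw [line_eval]
  congr 2
  funext i
  rcases i with i | i <;> simp [lineE, pairSub, -Polynomial.X_mul_C]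

lemma lineF_deriv (A B : Matrix (Fin n) (Fin n) K) (f : MvPolynomial (MatVar n) K) :
    Polynomial.derivative (aeval (lineF A B) f) = aeval (lineF A B) (opF K n f) := by
  apply line_deriv
  rintro (i | i) <;> simp [lineF]
lemma lineE_deriv (A B : Matrix (Fin n) (Fin n) K) (f : MvPolynomial (MatVar n) K) :
    Polynomial.derivative (aeval (lineE A B) f) = aeval (lineE A B) (opE K n f) := by
  apply line_deriv
  rintro (i | i) <;> simp [lineE]

lemma opF_eval (A B : Matrix (Fin n) (Fin n) K) (f : MvPolynomial (MatVar n) K) :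
    eval (pairSub A B) (opF K n f) = (Polynomial.derivative (aeval (lineF A B) f)).eval 0 := by
  rw [lineF_deriv, lineF_eval]; simp
lemma opE_eval (A B : Matrix (Fin n) (Fin n) K) (f : MvPolynomial (MatVar n) K) :
    eval (pairSub A B) (opE K n f) = (Polynomial.derivative (aeval (lineE A B) f)).eval 0 := by
  rw [lineE_deriv, lineE_eval]; simp

lemma pair_surj (v : MatVar n → K) : ∃ A B : Matrix (Fin n) (Fin n) K, v = pairSub A B := by
  refine ⟨fun i j => v (Sum.inl (i, j)), fun i j => v (Sum.inr (i, j)), ?_⟩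
  funext i
  rcases i with i | i <;> rfl

lemma pair_funext [Infinite K] {f g : MvPolynomial (MatVar n) K}
    (h : ∀ A B, eval (pairSub A B) f = eval (pairSub A B) g) : f = g := by
  apply MvPolynomial.funext
  intro v
  obtain ⟨A, B, rfl⟩ := pair_surj v
  exact h A B

variable [CharZero K]

lemma opF_zero_iff (f : MvPolynomial (MatVar n) K) : opF K n f = 0 ↔
    ∀ (A B : Matrix (Fin n) (Fin n) K) (s : K),
      eval (pairSub (A + s • B) B) f = eval (pairSub A B) f := by
  constructor
  · intro h A B s
    have h1 := lineF_deriv A B f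
    rw [h, map_zero] at h1
    have h2 := Polynomial.eq_C_of_derivative_eq_zero h1
    have h3 := lineF_eval A B f s
    have h4 := lineF_eval A B f 0
    rw [h2, Polynomial.eval_C] at h3 h4
    rw [← h3, h4]; simp
  · intro h
    apply pair_funext
    intro A B
    rw [opF_eval, map_zero]
    have : aeval (lineF A B) f = Polynomial.C (eval (pairSub A B) f) := by
      apply Polynomial.funext
      intro s
      rw [lineF_eval, h, Polynomial.eval_C]
    rw [this]; simp
lemma opE_zero_iff (f : MvPolynomial (MatVar n) K) : opE K n f = 0 ↔
    ∀ (A B : Matrix (Fin n) (Fin n) K) (s : K),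
      eval (pairSub A (B + s • A)) f = eval (pairSub A B) f := by
  constructor
  · intro h A B s
    have h1 := lineE_deriv A B f
    rw [h, map_zero] at h1
    have h2 := Polynomial.eq_C_of_derivative_eq_zero h1
    have h3 := lineE_eval A B f s
    have h4 := lineE_eval A B f 0
    rw [h2, Polynomial.eval_C] at h3 h4
    rw [← h3, h4]; simp
  · intro h
    apply pair_funext
    intro A B
    rw [opE_eval, map_zero]
    have : aeval (lineE A B) f = Polynomial.C (eval (pairSub A B) f) := by
      apply Polynomial.funext
      intro s
      rw [lineE_eval, h, Polynomial.eval_C]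
    rw [this]; simp

lemma opF_inv {f : MvPolynomial (MatVar n) K} (h : IsMatInvariant f) : IsMatInvariant (opF K n f) := by
  intro a A B
  rw [opF_eval, opF_eval]
  congr 2
  apply Polynomial.funext
  intro s
  rw [lineF_eval, lineF_eval, ← h a (A + s • B) B]
  simp [mul_add, add_mul]
lemma opE_inv {f : MvPolynomial (MatVar n) K} (h : IsMatInvariant f) : IsMatInvariant (opE K n f) := by
  intro a A B
  rw [opE_eval, opE_eval]
  congr 2
  apply Polynomial.funext
  intro s
  rw [lineE_eval, lineE_eval, ← h a A (B + s • A)]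
  simp [mul_add, add_mul]

lemma coeff_opH (f : MvPolynomial (MatVar n) K) (d : MatVar n →₀ ℕ) : coeff d (opH K n f) =
    (((∑ i, d (Sum.inl i) : ℕ) : K) - ((∑ i, d (Sum.inr i) : ℕ) : K)) * coeff d f := by
  induction f using MvPolynomial.induction_on' with
  | monomial e r =>
    have h : (monomial e r).IsWeightedHomogeneous (wt n) (∑ i, (e (Sum.inl i) : ℤ), ∑ i, (e (Sum.inr i) : ℤ)) :=
      isWeightedHomogeneous_monomial _ _ _ (weight_wt e)
    rw [opH_wt h, coeff_smul, coeff_monomial, smul_eq_mul]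
    split_ifs with h
    · subst h; push_cast; rfl
    · simp
  | add f g hf hg => rw [map_add, coeff_add, coeff_add, hf, hg]; ring

lemma sl2_inv_iff (f : MvPolynomial (MatVar n) K) :
    (∀ (g : Matrix.SpecialLinearGroup (Fin 2) K) (A B : Matrix (Fin n) (Fin n) K),
      MvPolynomial.eval
          (pairSub ((g : Matrix (Fin 2) (Fin 2) K) 0 0 • A + (g : Matrix (Fin 2) (Fin 2) K) 1 0 • B)
            ((g : Matrix (Fin 2) (Fin 2) K) 0 1 • A + (g : Matrix (Fin 2) (Fin 2) K) 1 1 • B)) f =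
        MvPolynomial.eval (pairSub A B) f) ↔ opF K n f = 0 ∧ opE K n f = 0 := by
  constructor
  · intro h
    rw [opF_zero_iff, opE_zero_iff]
    refine ⟨fun A B s => ?_, fun A B s => ?_⟩
    · simpa using h ⟨!![1, 0; s, 1], by simp [Matrix.det_fin_two]⟩ A B
    · have := h ⟨!![1, s; 0, 1], by simp [Matrix.det_fin_two]⟩ A B
      simpa [add_comm] using this
  · rintro ⟨hF, hE⟩
    rw [opF_zero_iff] at hF
    rw [opE_zero_iff] at hE
    have key : ∀ (α β γ δ : K) (A B : Matrix (Fin n) (Fin n) K), α * δ - β * γ = 1 → β ≠ 0 →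
        eval (pairSub (α • A + γ • B) (β • A + δ • B)) f = eval (pairSub A B) f := by
      intro α β γ δ A B h hb
      rw [← hF A B ((δ - 1) / β), ← hE _ B β, ← hF _ (B + β • _) ((α - 1) / β)]
      have e1 : B + β • (A + ((δ - 1) / β) • B) = β • A + δ • B := by
        rw [smul_add, smul_smul, mul_div_cancel₀ _ hb]; module
      rw [e1]
      congr 3
      have : γ = (δ - 1) / β + (α - 1) / β * δ := by field_simp; linear_combination -h
      have h2 : α = 1 + (α - 1) / β * β := by field_simp; ring
      rw [smul_add, smul_smul, smul_smul, ← add_assoc]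
      nth_rw 1 [this, h2]
      module
    intro g A B
    have hd := g.det_coe
    rw [Matrix.det_fin_two] at hd
    by_cases hb : (g : Matrix (Fin 2) (Fin 2) K) 0 1 = 0
    · have ha : (g : Matrix (Fin 2) (Fin 2) K) 0 0 ≠ 0 := by
        intro h; rw [hb, h] at hd; simp at hd
      rw [← hE _ _ 1, ← key _ _ ((g : Matrix (Fin 2) (Fin 2) K) 1 0)
        ((g : Matrix (Fin 2) (Fin 2) K) 1 1 + (g : Matrix (Fin 2) (Fin 2) K) 1 0) A B _ ha]
      · rw [hb]; congr 3; module
      · rw [hb] at hd; linear_combination hd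
    · exact key _ _ _ _ A B (by linear_combination hd) hb

end line

section main
variable (K : Type*) [Field K] (n : ℕ)

/-- the space of `GL_n`-invariants -/
def Rinv : Submodule K (MvPolynomial (MatVar n) K) where
  carrier := {f | IsMatInvariant f}
  zero_mem' := by intro a A B; simp
  add_mem' := by intro f g hf hg a A B; rw [map_add, map_add, hf, hg]
  smul_mem' := by intro c f hf a A B; rw [smul_eval, smul_eval, hf]

def Rb (p q : ℤ) : Submodule K (MvPolynomial (MatVar n) K) :=
  Rinv K n ⊓ weightedHomogeneousSubmodule K (wt n) (p, q)

variable {K n} [CharZero K]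

lemma Rb_F {p q : ℤ} {f : MvPolynomial (MatVar n) K} (h : f ∈ Rb K n p q) :
    opF K n f ∈ Rb K n (p - 1) (q + 1) := ⟨opF_inv h.1, opF_wt h.2⟩
lemma Rb_E {p q : ℤ} {f : MvPolynomial (MatVar n) K} (h : f ∈ Rb K n p q) :
    opE K n f ∈ Rb K n (p + 1) (q - 1) := ⟨opE_inv h.1, opE_wt h.2⟩

lemma Rb_F_pow (N : ℕ) {p q : ℤ} {f : MvPolynomial (MatVar n) K} (h : f ∈ Rb K n p q) :
    ((opF K n : MvPolynomial (MatVar n) K →ₗ[K] MvPolynomial (MatVar n) K) ^ N) f ∈ Rb K n (p - N) (q + N) := by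
  induction N with
  | zero => simpa using h
  | succ N ih =>
    rw [pow_succ', Module.End.mul_apply]
    have := Rb_F ih
    push_cast
    rwa [← sub_sub, ← add_assoc]
lemma Rb_E_pow (N : ℕ) {p q : ℤ} {f : MvPolynomial (MatVar n) K} (h : f ∈ Rb K n p q) :
    ((opE K n : MvPolynomial (MatVar n) K →ₗ[K] MvPolynomial (MatVar n) K) ^ N) f ∈ Rb K n (p + N) (q - N) := by
  induction N with
  | zero => simpa using h
  | succ N ih =>
    rw [pow_succ', Module.End.mul_apply]
    have := Rb_E ih
    push_cast
    rwa [← sub_sub, ← add_assoc]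

lemma Rb_F_surj (m : ℕ) {f : MvPolynomial (MatVar n) K} (h : f ∈ Rb K n (m - 1) (m + 1)) :
    ∃ g ∈ Rb K n m m, opF K n g = f := by
  refine sl2_surj (opE K n : MvPolynomial (MatVar n) K →ₗ[K] MvPolynomial (MatVar n) K) (opF K n)
    (opH K n) (fun v => rfl) opHF (Rb K n (m - 1) (m + 1)) (Rb K n m m) 2 (by norm_num) ?_ ?_ ?_ (m + 1)
    f h ?_
  · intro w hw
    have := opH_wt hw.2
    simp only [Derivation.coeFn_coe]
    rw [this]; congr 1; push_cast; ring
  · intro w hw; simpa using Rb_E hw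
  · intro w hw; simpa using Rb_F hw
  · refine wt_neg (Rb_F_pow (m + 1) h).2 (Or.inl ?_)
    push_cast; omega

lemma Rb_F_ker (m : ℕ) {f : MvPolynomial (MatVar n) K} (h : f ∈ Rb K n m m) (hF : opF K n f = 0) :
    opE K n f = 0 := by
  have h0 : opH K n f = 0 := by rw [opH_wt h.2]; simp
  refine sl2_ker (opF K n : MvPolynomial (MatVar n) K →ₗ[K] MvPolynomial (MatVar n) K) (opE K n)
    (-(opH K n)) (fun v => ?_) (fun v => ?_) f ?_ hF m ?_
  · simp only [Derivation.coeFn_coe, LinearMap.neg_apply, opH, Derivation.commutator_apply]; abel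
  · simp only [Derivation.coeFn_coe, LinearMap.neg_apply, opHE, map_neg]; abel
  · simp [h0]
  · refine wt_neg (Rb_E_pow (m + 1) h).2 (Or.inr ?_)
    push_cast; omega

lemma sharp_coeff {k : ℕ} {f : MvPolynomial (MatVar n) K} (hf : f ∈ sharpComponent K n k)
    {d : MatVar n →₀ ℕ} (hd : coeff d f ≠ 0) :
    (∑ i, d (Sum.inl i)) = (∑ i, d (Sum.inr i)) ∧ (∑ i, d (Sum.inl i)) + (∑ i, d (Sum.inr i)) = k := by
  obtain ⟨⟨h1, h2⟩, h3⟩ := hf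
  rw [sl2_inv_iff] at h2
  have h0 : opH K n f = 0 := by rw [opH, Derivation.commutator_apply, h2.1, h2.2]; simp
  have h4 := coeff_opH f d
  rw [h0, coeff_zero, eq_comm, mul_eq_zero, or_iff_left hd, sub_eq_zero, Nat.cast_inj] at h4
  refine ⟨h4, ?_⟩
  have := h3 hd
  rw [Finsupp.weight_apply, Finsupp.sum_fintype _ _ (by simp), Fintype.sum_sum_type] at this
  simpa using this

lemma sharp_even (m : ℕ) : sharpComponent K n (2 * m) =
    ((LinearMap.ker (opF K n : MvPolynomial (MatVar n) K →ₗ[K] MvPolynomial (MatVar n) K) ⊓ Rb K n m m :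
      Submodule K _) : Set (MvPolynomial (MatVar n) K)) := by
  ext f
  constructor
  · intro hf
    have hf' := hf
    obtain ⟨⟨h1, h2⟩, h3⟩ := hf'
    rw [sl2_inv_iff] at h2
    refine ⟨h2.1, h1, ?_⟩
    intro d hd
    have := sharp_coeff hf hd
    rw [weight_wt]
    simp only [← Nat.cast_sum, Prod.mk.injEq, Nat.cast_inj]
    omega
  · rintro ⟨h1, h2⟩
    have h1 : opF K n f = 0 := h1
    refine ⟨⟨h2.1, (sl2_inv_iff f).2 ⟨h1, Rb_F_ker m h2 h1⟩⟩, ?_⟩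
    intro d hd
    have := h2.2 hd
    rw [weight_wt] at this
    simp only [← Nat.cast_sum, Prod.mk.injEq, Nat.cast_inj] at this
    rw [Finsupp.weight_apply, Finsupp.sum_fintype _ _ (by simp), Fintype.sum_sum_type]
    simp only [Pi.one_apply, smul_eq_mul, mul_one]
    omega

theorem sharpDim_odd (m : ℕ) : sharpDim K n (2 * m + 1) = 0 := by
  have : sharpComponent K n (2 * m + 1) ⊆ {0} := by
    intro f hf
    rw [Set.mem_singleton_iff]
    by_contra h0
    obtain ⟨d, hd⟩ := exists_coeff_ne_zero h0
    have := sharp_coeff hf hd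
    omega
  have h2 : Submodule.span K (sharpComponent K n (2 * m + 1)) = ⊥ := by
    rw [Submodule.span_eq_bot]; intro x hx; exact this hx
  rw [sharpDim, Set.finrank, h2, finrank_bot]

theorem sharpDim_even (hfin : ∀ p q, FiniteDimensional K (Rb K n p q)) (m : ℕ) :
    sharpDim K n (2 * m) + Module.finrank K (Rb K n (m - 1) (m + 1)) = Module.finrank K (Rb K n m m) := by
  have := hfin
  let φ : Rb K n m m →ₗ[K] Rb K n (m - 1) (m + 1) :=
    (opF K n : MvPolynomial (MatVar n) K →ₗ[K] MvPolynomial (MatVar n) K).restrict (fun f hf => Rb_F hf)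
  have hs : Function.Surjective φ := by
    rintro ⟨f, hf⟩
    obtain ⟨g, hg, h⟩ := Rb_F_surj m hf
    exact ⟨⟨g, hg⟩, Subtype.ext h⟩
  have h1 := LinearMap.finrank_range_add_finrank_ker φ
  rw [LinearMap.range_eq_top.2 hs, finrank_top] at h1
  have h2 : sharpDim K n (2 * m) = Module.finrank K (LinearMap.ker φ) := by
    rw [sharpDim, Set.finrank, sharp_even, Submodule.span_eq]
    rw [← LinearMap.finrank_range_of_inj (f := (Rb K n m m).subtype ∘ₗ (LinearMap.ker φ).subtype)
      (by rw [LinearMap.coe_comp]; exact (Subtype.val_injective).comp Subtype.val_injective)]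
    refine congrArg (fun S : Submodule K (MvPolynomial (MatVar n) K) => Module.finrank K S) ?_
    ext f
    simp only [Submodule.mem_inf, LinearMap.mem_ker, LinearMap.mem_range, LinearMap.comp_apply]
    constructor
    · rintro ⟨h1, h2⟩
      exact ⟨⟨⟨f, h2⟩, by rw [LinearMap.mem_ker]; exact Subtype.ext h1⟩, rfl⟩
    · rintro ⟨⟨⟨g, hg⟩, h⟩, rfl⟩
      rw [LinearMap.mem_ker] at h
      exact ⟨congrArg Subtype.val h, hg⟩
  omega
end main

abbrev SS := PowerSeries (PowerSeries ℚ)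
def sv : SS := PowerSeries.X
def tv : SS := PowerSeries.C PowerSeries.X
/-- bivariate coefficient of `s^p t^q` -/
def cf (p q : ℕ) (G : SS) : ℚ := PowerSeries.coeff q (PowerSeries.coeff p G)

lemma cf_ext {G H : SS} (h : ∀ p q, cf p q G = cf p q H) : G = H := by
  apply PowerSeries.ext; intro p; apply PowerSeries.ext; intro q; exact h p q

lemma cf_add (p q) (G H : SS) : cf p q (G + H) = cf p q G + cf p q H := by simp [cf]
lemma cf_sub (p q) (G H : SS) : cf p q (G - H) = cf p q G - cf p q H := by simp [cf]

lemma cf_mul_mon (p q a b : ℕ) (G : SS) : cf p q (G * (sv ^ a * tv ^ b)) =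
    if a ≤ p ∧ b ≤ q then cf (p - a) (q - b) G else 0 := by
  rw [cf, sv, tv, ← map_pow, mul_comm (PowerSeries.X ^ a), ← mul_assoc, PowerSeries.coeff_mul_X_pow']
  by_cases h1 : a ≤ p
  · rw [if_pos h1, PowerSeries.coeff_mul_C, PowerSeries.coeff_mul_X_pow']
    simp [h1, cf]
  · simp [h1]

lemma cf_mul (p q : ℕ) (G H : SS) : cf p q (G * H) =
    ∑ x ∈ Finset.HasAntidiagonal.antidiagonal p, ∑ y ∈ Finset.HasAntidiagonal.antidiagonal q, cf x.1 y.1 G * cf x.2 y.2 H := by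
  rw [cf, PowerSeries.coeff_mul, map_sum]
  refine Finset.sum_congr rfl fun x _ => ?_
  rw [PowerSeries.coeff_mul]; rfl

lemma cf_algebraMap (p q : ℕ) (r : ℚ) : cf p q (algebraMap ℚ SS r) = if p = 0 ∧ q = 0 then r else 0 := by
  have : algebraMap ℚ SS r = PowerSeries.C (PowerSeries.C r) := by
    rw [PowerSeries.algebraMap_apply, PowerSeries.algebraMap_apply]; rfl
  rw [this, cf, PowerSeries.coeff_C]
  by_cases hp : p = 0
  · simp [hp, PowerSeries.coeff_C]
  · simp [hp]

def coneS : Subalgebra ℚ SS where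
  carrier := {G | ∀ i j, i < j → cf i j G = 0}
  mul_mem' := by
    intro G H hG hH i j hij
    rw [cf_mul]
    refine Finset.sum_eq_zero fun x hx => Finset.sum_eq_zero fun y hy => ?_
    rw [Finset.HasAntidiagonal.mem_antidiagonal] at hx hy
    by_cases h : x.1 < y.1
    · rw [hG _ _ h, zero_mul]
    · rw [hH x.2 y.2 (by omega), mul_zero]
  add_mem' := by
    intro G H hG hH i j hij
    rw [cf_add, hG _ _ hij, hH _ _ hij, add_zero]
  algebraMap_mem' := by
    intro r i j hij
    rw [cf_algebraMap, if_neg (by omega)]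

def coneT : Subalgebra ℚ SS where
  carrier := {G | ∀ i j, j < i → cf i j G = 0}
  mul_mem' := by
    intro G H hG hH i j hij
    rw [cf_mul]
    refine Finset.sum_eq_zero fun x hx => Finset.sum_eq_zero fun y hy => ?_
    rw [Finset.HasAntidiagonal.mem_antidiagonal] at hx hy
    by_cases h : y.1 < x.1
    · rw [hG _ _ h, zero_mul]
    · rw [hH x.2 y.2 (by omega), mul_zero]
  add_mem' := by
    intro G H hG hH i j hij
    rw [cf_add, hG _ _ hij, hH _ _ hij, add_zero]
  algebraMap_mem' := by
    intro r i j hij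
    rw [cf_algebraMap, if_neg (by omega)]

lemma cf_mon (p q a b : ℕ) : cf p q (sv ^ a * tv ^ b) = if p = a ∧ q = b then 1 else 0 := by
  have h := cf_mul_mon p q a b (algebraMap ℚ SS 1)
  rw [map_one, one_mul] at h
  rw [h]
  have h2 := cf_algebraMap (p - a) (q - b) 1
  rw [map_one] at h2
  rw [h2]
  split_ifs <;> first | rfl | omega

lemma mon_memS {a b : ℕ} (h : b ≤ a) : sv ^ a * tv ^ b ∈ coneS := by
  intro i j hij
  rw [cf_mon, if_neg (by omega)]
lemma mon_memT {a b : ℕ} (h : a ≤ b) : sv ^ a * tv ^ b ∈ coneT := by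
  intro i j hij
  rw [cf_mon, if_neg (by omega)]

lemma cf_div {a b : ℕ} (G : SS) (i j : ℕ) : cf i j G = cf i j (G * (1 - sv ^ a * tv ^ b)) +
    if a ≤ i ∧ b ≤ j then cf (i - a) (j - b) G else 0 := by
  rw [mul_sub, mul_one, cf_sub, cf_mul_mon]; ring

lemma divS {a b : ℕ} (h : b ≤ a) (h0 : 0 < a) {G : SS} (hG : G * (1 - sv ^ a * tv ^ b) ∈ coneS) :
    G ∈ coneS := by
  intro i
  induction i using Nat.strong_induction_on with
  | _ i ih =>
    intro j hij
    rw [cf_div (a := a) (b := b), hG i j hij, zero_add]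
    split_ifs with h1
    · exact ih _ (by omega) _ (by omega)
    · rfl
lemma divT {a b : ℕ} (h : a ≤ b) (h0 : 0 < b) {G : SS} (hG : G * (1 - sv ^ a * tv ^ b) ∈ coneT) :
    G ∈ coneT := by
  intro i j
  induction j using Nat.strong_induction_on generalizing i with
  | _ j ih =>
    intro hij
    rw [cf_div (a := a) (b := b), hG i j hij, zero_add]
    split_ifs with h1
    · exact ih _ (by omega) _ (by omega)
    · rfl

/-- diagonal extraction -/
def dg : SS →ₗ[ℚ] PowerSeries ℚ where
  toFun G := PowerSeries.mk fun k => if Even k then cf (k / 2) (k / 2 + 1) G else 0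
  map_add' G H := by
    ext k; simp only [PowerSeries.coeff_mk, map_add, cf_add]; split_ifs <;> simp
  map_smul' c G := by
    ext k; simp only [PowerSeries.coeff_mk, PowerSeries.coeff_smul, RingHom.id_apply, smul_eq_mul]
    split_ifs
    · have := cf_mul (k / 2) (k / 2 + 1) (algebraMap ℚ SS c) G
      simp [cf]
    · simp

lemma dg_coneS {G : SS} (h : G ∈ coneS) : dg G = 0 := by
  ext k
  simp only [dg, LinearMap.coe_mk, AddHom.coe_mk, PowerSeries.coeff_mk, map_zero]
  split_ifs
  · exact h _ _ (by omega)
  · rfl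
lemma dg_coneT {G : SS} (h : G ∈ coneT) : dg (G * tv ^ 2) = 0 := by
  ext k
  simp only [dg, LinearMap.coe_mk, AddHom.coe_mk, PowerSeries.coeff_mk, map_zero]
  split_ifs
  · have := cf_mul_mon (k / 2) (k / 2 + 1) 0 2 G
    rw [pow_zero, one_mul] at this
    rw [this]
    split_ifs
    · exact h _ _ (by omega)
    · rfl
  · rfl

lemma dg_mul (G : SS) : dg (G * (sv * tv)) = dg G * pu ^ 2 := by
  ext k
  rw [pu, PowerSeries.coeff_mul_X_pow']
  simp only [dg, LinearMap.coe_mk, AddHom.coe_mk, PowerSeries.coeff_mk]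
  have := cf_mul_mon (k / 2) (k / 2 + 1) 1 1 G
  rw [pow_one, pow_one] at this
  rw [this]
  by_cases h : 2 ≤ k
  · obtain ⟨k, rfl⟩ := Nat.exists_eq_add_of_le' h
    simp [Nat.even_add]
  · have : k / 2 = 0 := by omega
    simp [h, this]

lemma dg_aeval (G : SS) (P : Polynomial ℚ) : dg (G * Polynomial.aeval (sv * tv) P) =
    dg G * Polynomial.aeval (pu ^ 2) P := by
  induction P using Polynomial.induction_on with
  | C a =>
    rw [Polynomial.aeval_C, Polynomial.aeval_C, mul_comm, ← Algebra.smul_def, map_smul,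
      mul_comm, ← Algebra.smul_def]
  | add P Q hP hQ => simp [mul_add, hP, hQ]
  | monomial n a h =>
    simp only [map_mul, map_pow, Polynomial.aeval_X] at h ⊢
    rw [pow_succ (sv * tv) n, pow_succ (pu ^ 2) n, ← mul_assoc, ← mul_assoc, dg_mul, mul_assoc G, h]
    ring

lemma dg_tv : dg tv = 1 := by
  ext k
  simp only [dg, LinearMap.coe_mk, AddHom.coe_mk, PowerSeries.coeff_mk, PowerSeries.coeff_one]
  have := cf_mon (k / 2) (k / 2 + 1) 0 1
  rw [pow_zero, one_mul, pow_one] at this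
  rw [this]
  by_cases h : k = 0
  · simp [h]
  · by_cases h2 : Even k
    · have : k / 2 ≠ 0 := by obtain ⟨r, rfl⟩ := h2; omega
      simp [h, this]
    · simp [h, h2]

section count
def cnt {N : ℕ} (w : Fin N → ℕ × ℕ) (r : ℕ × ℕ) : ℕ :=
  Nat.card {e : Fin N → ℕ // ∑ i, e i • w i = r}

lemma cnt_finite {N : ℕ} (w : Fin N → ℕ × ℕ) (hw : ∀ i, w i ≠ 0) (r : ℕ × ℕ) :
    Finite {e : Fin N → ℕ // ∑ i, e i • w i = r} := by
  apply Set.Finite.to_subtype (s := {e : Fin N → ℕ | ∑ i, e i • w i = r})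
  refine Set.Finite.subset (Set.finite_Iic (fun _ : Fin N => r.1 + r.2)) ?_
  intro e he i
  have he : ∑ i, e i • w i = r := he
  have h1 : e i • w i ≤ r := by
    rw [← he]
    exact Finset.single_le_sum (f := fun i => e i • w i) (fun _ _ => zero_le) (Finset.mem_univ i)
  have h2 : 0 < (w i).1 + (w i).2 := by
    by_contra h
    apply hw i
    ext <;> simp <;> omega
  have h3 := h1.1
  have h4 := h1.2
  simp only [Prod.smul_fst, Prod.smul_snd, smul_eq_mul] at h3 h4
  have h5 : e i ≤ e i * ((w i).1 + (w i).2) := Nat.le_mul_of_pos_right _ h2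
  show e i ≤ r.1 + r.2
  rw [mul_add] at h5
  omega

lemma cnt_zero (w : Fin 0 → ℕ × ℕ) (r : ℕ × ℕ) : cnt w r = if r = 0 then 1 else 0 := by
  rw [cnt]
  split_ifs with h
  · subst h
    rw [Nat.card_eq_one_iff_unique]
    exact ⟨⟨fun a b => Subtype.ext (Subsingleton.elim _ _)⟩, ⟨⟨0, by simp⟩⟩⟩
  · rw [Nat.card_eq_zero]
    left
    refine ⟨fun ⟨e, he⟩ => h ?_⟩
    simpa using he.symm

lemma cnt_lt {N : ℕ} (w : Fin (N + 1) → ℕ × ℕ) (r : ℕ × ℕ) (h : ¬ w 0 ≤ r) :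
    cnt w r = cnt (Fin.tail w) r := by
  refine (Nat.card_congr ?_).symm
  refine Equiv.ofBijective (fun e => ⟨Fin.cons 0 e.1, by
    rw [Fin.sum_univ_succ]; simpa [Fin.tail] using e.2⟩) ⟨?_, ?_⟩
  · rintro ⟨a, ha⟩ ⟨b, hb⟩ hab
    simpa using hab
  · rintro ⟨e, he⟩
    have h0 : e 0 = 0 := by
      by_contra h0
      apply h
      rw [← he, Fin.sum_univ_succ]
      obtain ⟨k, hk⟩ := Nat.exists_eq_succ_of_ne_zero h0
      rw [hk, succ_nsmul, add_comm _ (w 0), add_assoc]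
      exact le_self_add
    refine ⟨⟨Fin.tail e, ?_⟩, ?_⟩
    · rw [Fin.sum_univ_succ, h0] at he
      simpa [Fin.tail] using he
    · simp only [Subtype.mk.injEq]
      rw [← h0, Fin.cons_self_tail]

lemma cnt_add {N : ℕ} (w : Fin (N + 1) → ℕ × ℕ) (hw : ∀ i, w i ≠ 0) (r : ℕ × ℕ) :
    cnt w (r + w 0) = cnt (Fin.tail w) (r + w 0) + cnt w r := by
  have := cnt_finite w hw
  have := cnt_finite (Fin.tail w) (fun i => hw _)
  rw [cnt, cnt, cnt, ← Nat.card_sum]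
  symm
  apply Nat.card_congr
  refine Equiv.ofBijective (Sum.elim (fun e => ⟨Fin.cons 0 e.1, by
    rw [Fin.sum_univ_succ]; simpa [Fin.tail] using e.2⟩) (fun e => ⟨Fin.cons (e.1 0 + 1) (Fin.tail e.1), by
    have := e.2
    rw [Fin.sum_univ_succ] at this ⊢
    refine Eq.trans ?_ (congrArg (· + w 0) this)
    simp [Fin.tail, add_smul]; abel⟩)) ⟨?_, ?_⟩
  · rintro (⟨a, ha⟩ | ⟨a, ha⟩) (⟨b, hb⟩ | ⟨b, hb⟩) hab
    · simpa using hab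
    · have := congrFun (congrArg Subtype.val hab) 0
      simp at this
    · have := congrFun (congrArg Subtype.val hab) 0
      simp at this
    · simp only [Sum.elim_inr, Subtype.mk.injEq, Fin.cons_inj, add_left_inj] at hab
      congr 2
      rw [← Fin.cons_self_tail a, ← Fin.cons_self_tail b, hab.1, hab.2]
  · rintro ⟨e, he⟩
    rcases Nat.eq_zero_or_eq_succ_pred (e 0) with h0 | h0
    · refine ⟨Sum.inl ⟨Fin.tail e, ?_⟩, ?_⟩
      · rw [Fin.sum_univ_succ, h0] at he
        simpa [Fin.tail] using he
      · simp only [Sum.elim_inl, Subtype.mk.injEq]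
        rw [← h0, Fin.cons_self_tail]
    · refine ⟨Sum.inr ⟨Fin.cons (e 0).pred (Fin.tail e), ?_⟩, ?_⟩
      · rw [Fin.sum_univ_succ, h0, succ_nsmul] at he
        rw [Fin.sum_univ_succ]
        apply add_right_cancel (b := w 0)
        rw [← he]
        simp [Fin.tail]; abel
      · simp only [Sum.elim_inr, Subtype.mk.injEq, Fin.cons_zero, Fin.tail_cons]
        have h1 : (e 0).pred + 1 = e 0 := h0.symm
        rw [h1, Fin.cons_self_tail]

def gen {N : ℕ} (w : Fin N → ℕ × ℕ) : SS :=
  PowerSeries.mk fun p => PowerSeries.mk fun q => (cnt w (p, q) : ℚ)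

lemma cf_gen {N : ℕ} (w : Fin N → ℕ × ℕ) (p q : ℕ) : cf p q (gen w) = cnt w (p, q) := by
  simp [cf, gen]

lemma gen_zero (w : Fin 0 → ℕ × ℕ) : gen w = 1 := by
  apply cf_ext
  intro p q
  have := cf_mon p q 0 0
  simp only [pow_zero, mul_one] at this
  rw [cf_gen, this, cnt_zero]
  simp [Prod.ext_iff]

lemma gen_succ {N : ℕ} (w : Fin (N + 1) → ℕ × ℕ) (hw : ∀ i, w i ≠ 0) :
    gen w * (1 - sv ^ (w 0).1 * tv ^ (w 0).2) = gen (Fin.tail w) := by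
  apply cf_ext
  intro p q
  rw [mul_sub, mul_one, cf_sub, cf_mul_mon]
  simp only [cf_gen]
  split_ifs with h
  · have := cnt_add w hw (p - (w 0).1, q - (w 0).2)
    have e : (p - (w 0).1, q - (w 0).2) + w 0 = (p, q) := by
      ext <;> simp [h.1, h.2]
    rw [e] at this
    rw [this]; push_cast; ring
  · rw [cnt_lt w (p, q) h, sub_zero]

lemma gen_prod : ∀ {N : ℕ} (w : Fin N → ℕ × ℕ) (_ : ∀ i, w i ≠ 0),
    gen w * ∏ i, (1 - sv ^ (w i).1 * tv ^ (w i).2) = 1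
  | 0, w, _ => by rw [gen_zero]; simp
  | N + 1, w, hw => by
    rw [Fin.prod_univ_succ, ← mul_assoc, gen_succ w hw]
    exact gen_prod (Fin.tail w) (fun i => hw _)
end count

def cNum3 {R : Type*} [CommRing R] (q : R) : R :=
  1 - q + 3*q^4 - 2*q^5 + 2*q^6 - 3*q^7 + q^10 - q^11
def cA3 {R : Type*} [CommRing R] (s q : R) : R :=
  (- 1 + q - 3*q^4 + 2*q^5 - 2*q^6 + 3*q^7 - q^10 + q^11)*s
  + (- 2*q^2 - q^3 + 4*q^4 + q^5 - q^6 - 2*q^8 + 2*q^10 - q^12)*s^2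
  + (- q + 3*q^3 + q^4 - 4*q^5 + 4*q^6 - 3*q^7 + q^8 + q^9 - 3*q^11 + q^12)*s^3
  + (- q + 3*q^2 - q^4 - q^5 + 3*q^6 - 4*q^7 + 4*q^8 - q^9 - 3*q^10 + q^12)*s^4
  + (q - 2*q^3 + 2*q^5 + q^7 - q^8 - 4*q^9 + q^10 + 2*q^11)*s^5
  + (- q^2 + q^3 - 3*q^6 + 2*q^7 - 2*q^8 + 3*q^9 - q^12 + q^13)*s^6
def cB3 {R : Type*} [CommRing R] (t q : R) : R :=
  (1 + q^2 + q^3 - q^4 + q^6 - q^7 - q^8 - q^10)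
  + (1 - q + q^2 - 3*q^3 + 2*q^4 - q^5 - 2*q^7 + 2*q^8 - q^9 + q^10 + q^11)*t
  + (- 2*q^2 + q^4 - 2*q^5 - q^6 + 2*q^7 - q^8 + q^9 + 3*q^10 - q^11)*t^2
  + (- 1 + 2*q^3 - 3*q^4 - 2*q^6 + 2*q^7 + q^8 + 4*q^9 - 2*q^10 - q^11)*t^3
  + (- 1 + 2*q - q^3 - 3*q^4 + 5*q^5 - q^6 + 3*q^7 - q^8 - 3*q^9 - q^10 + 2*q^11 - q^13)*t^4
  + (1 - q^2 + 3*q^4 + q^5 - q^7 - 3*q^8 + q^10 - q^12)*t^5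
  + (- q + q^2 - 3*q^5 + 2*q^6 - 2*q^7 + 3*q^8 - q^11 + q^12)*t^6
def cNum2 {R : Type*} [CommRing R] (q : R) : R :=
  1 - q
def cA2 {R : Type*} [CommRing R] (s q : R) : R :=
  (- 1 + q)*s
  + (- q + q^2)*s^2
def cB2 {R : Type*} [CommRing R] (t q : R) : R :=
  (1 - q^2)
  + (1 - q)*t
  + (- 1 + q)*t^2

lemma cNum3_map {R S : Type*} [CommRing R] [CommRing S] (f : R →+* S) (q : R) :
    f (cNum3 q) = cNum3 (f q) := by
  have h2 : f 2 = 2 := map_ofNat f 2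
  have h3 : f 3 = 3 := map_ofNat f 3
  simp [cNum3, h2, h3]
lemma cA3_map {R S : Type*} [CommRing R] [CommRing S] (f : R →+* S) (s q : R) :
    f (cA3 s q) = cA3 (f s) (f q) := by
  have h2 : f 2 = 2 := map_ofNat f 2
  have h3 : f 3 = 3 := map_ofNat f 3
  have h4 : f 4 = 4 := map_ofNat f 4
  simp [cA3, h2, h3, h4]
lemma cB3_map {R S : Type*} [CommRing R] [CommRing S] (f : R →+* S) (s q : R) :
    f (cB3 s q) = cB3 (f s) (f q) := by
  have h2 : f 2 = 2 := map_ofNat f 2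
  have h3 : f 3 = 3 := map_ofNat f 3
  have h4 : f 4 = 4 := map_ofNat f 4
  have h5 : f 5 = 5 := map_ofNat f 5
  simp [cB3, h2, h3, h4, h5]

lemma cert3 {R : Type*} [CommRing R] (s t : R) :
    (t - s) * ((1-(s*t)^2)^2*(1-(s*t)^3)^2*(1-(s*t)^4)*(1-(s*t)^6)) =
     t * cNum3 (s*t) * (((1-s)*(1-s^2)*(1-s^2*t)*(1-s^3)) * ((1-t)*(1-t^2)*(1-s*t^2)*(1-t^3)))
     + cA3 s (s*t) * ((1-t)*(1-t^2)*(1-s*t^2)*(1-t^3))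
     + t^2 * cB3 t (s*t) * ((1-s)*(1-s^2)*(1-s^2*t)*(1-s^3)) := by
  unfold cNum3 cA3 cB3; ring
lemma cert2 {R : Type*} [CommRing R] (s t : R) :
    (t - s) * ((1-(s*t)^2)^2) =
     t * cNum2 (s*t) * (((1-s)*(1-s^2)) * ((1-t)*(1-t^2)))
     + cA2 s (s*t) * ((1-t)*(1-t^2))
     + t^2 * cB2 t (s*t) * ((1-s)*(1-s^2)) := by
  unfold cNum2 cA2 cB2; ring

lemma sv_memS : sv ∈ coneS := by have := mon_memS (a := 1) (b := 0) (by omega); simpa using this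
lemma q_memS : sv * tv ∈ coneS := by
  have := mon_memS (a := 1) (b := 1) (by omega); simpa using this
lemma tv_memT : tv ∈ coneT := by have := mon_memT (a := 0) (b := 1) (by omega); simpa using this
lemma q_memT : sv * tv ∈ coneT := by
  have := mon_memT (a := 1) (b := 1) (by omega); simpa using this

lemma cA3_mem : cA3 sv (sv * tv) ∈ coneS := by
  have := cA3_map (coneS.val : coneS →+* SS) ⟨sv, sv_memS⟩ ⟨sv * tv, q_memS⟩
  exact this ▸ Subtype.prop _
lemma cB3_mem : cB3 tv (sv * tv) ∈ coneT := by
  have := cB3_map (coneT.val : coneT →+* SS) ⟨tv, tv_memT⟩ ⟨sv * tv, q_memT⟩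
  exact this ▸ Subtype.prop _
lemma cA2_mem : cA2 sv (sv * tv) ∈ coneS := by
  have : coneS.val (cA2 ⟨sv, sv_memS⟩ ⟨sv * tv, q_memS⟩) = cA2 sv (sv * tv) := by simp [cA2]
  exact this ▸ Subtype.prop _
lemma cB2_mem : cB2 tv (sv * tv) ∈ coneT := by
  have : coneT.val (cB2 ⟨tv, tv_memT⟩ ⟨sv * tv, q_memT⟩) = cB2 tv (sv * tv) := by simp [cB2]
  exact this ▸ Subtype.prop _

lemma dg_main {U Dp Dm A B : SS} {Den Num : Polynomial ℚ}
    (hU : U * (Dp * Dm) = 1)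
    (hc : (tv - sv) * Polynomial.aeval (sv * tv) Den = tv * Polynomial.aeval (sv * tv) Num * (Dp * Dm)
      + A * Dm + tv ^ 2 * B * Dp) (hA : A ∈ coneS) (hB : B ∈ coneT)
    (h1 : U * Dm ∈ coneS) (h2 : U * Dp ∈ coneT) :
    dg ((tv - sv) * U) * Polynomial.aeval (pu ^ 2) Den = Polynomial.aeval (pu ^ 2) Num := by
  rw [← dg_aeval]
  have : (tv - sv) * U * Polynomial.aeval (sv * tv) Den = tv * Polynomial.aeval (sv * tv) Num +
      A * (U * Dm) + (B * (U * Dp)) * tv ^ 2 := by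
    linear_combination U * hc + tv * Polynomial.aeval (sv * tv) Num * hU
  rw [this, map_add, map_add, dg_coneS (coneS.mul_mem hA h1), dg_coneT (coneT.mul_mem hB h2),
    dg_aeval, dg_tv]
  ring

def w2 : Fin 5 → ℕ × ℕ := ![(2,0),(1,0),(0,1),(1,1),(0,2)]
def w3 : Fin 10 → ℕ × ℕ := ![(3,0),(1,0),(2,0),(0,1),(1,1),(2,1),(0,2),(1,2),(2,2),(0,3)]

lemma divS1 {a b : ℕ} (h : b ≤ a) (h0 : 0 < a) {G D : SS} (hD : D = 1 - sv ^ a * tv ^ b)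
   (hG : G * D ∈ coneS) : G ∈ coneS := divS h h0 (hD ▸ hG)
lemma divT1 {a b : ℕ} (h : a ≤ b) (h0 : 0 < b) {G D : SS} (hD : D = 1 - sv ^ a * tv ^ b)
   (hG : G * D ∈ coneT) : G ∈ coneT := divT h h0 (hD ▸ hG)

lemma w2_ne (i) : w2 i ≠ 0 := by fin_cases i <;> simp [w2]
lemma w3_ne (i) : w3 i ≠ 0 := by fin_cases i <;> simp [w3]

lemma final2 : dg ((tv - sv) * gen w2) * (1 - pu ^ 4) ^ 2 = 1 := by
  have hg := gen_prod w2 w2_ne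
  have hp : ∏ i, (1 - sv ^ (w2 i).1 * tv ^ (w2 i).2) =
      (1 - sv ^ 2) * ((1 - sv) * ((1 - tv) * ((1 - sv * tv) * (1 - tv ^ 2)))) := by
    simp [Fin.prod_univ_succ, w2]
  rw [hp] at hg
  have hU : (gen w2 * (1 - sv * tv)) * (((1-sv)*(1-sv^2)) * ((1-tv)*(1-tv^2))) = 1 := by
    refine Eq.trans ?_ hg; ac_rfl
  have hm := dg_main (Den := (1 - Polynomial.X ^ 2) ^ 2) (Num := 1 - Polynomial.X) hU
    (A := cA2 sv (sv * tv)) (B := cB2 tv (sv * tv))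
    (by simpa [cNum2] using cert2 sv tv) cA2_mem cB2_mem
    (by
      refine divS1 (a := 1) (b := 0) (D := 1 - sv) (by omega) (by omega) (by simp) ?_
      refine divS1 (a := 2) (b := 0) (D := 1 - sv^2) (by omega) (by omega) (by simp) ?_
      convert coneS.one_mem using 1
      refine Eq.trans ?_ hU; ac_rfl)
    (by
      refine divT1 (a := 0) (b := 1) (D := 1 - tv) (by omega) (by omega) (by simp) ?_
      refine divT1 (a := 0) (b := 2) (D := 1 - tv^2) (by omega) (by omega) (by simp) ?_
      convert coneT.one_mem using 1
      refine Eq.trans ?_ hU; ac_rfl)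
  have h3 : dg ((tv - sv) * (gen w2 * (1 - sv * tv))) = dg ((tv - sv) * gen w2) * (1 - pu ^ 2) := by
    have := dg_aeval ((tv - sv) * gen w2) (1 - Polynomial.X)
    simp only [map_sub, map_one, Polynomial.aeval_X] at this
    rw [← this, mul_assoc]
  rw [h3] at hm
  simp only [map_sub, map_one, Polynomial.aeval_X, map_pow] at hm
  have hne : (1 - pu ^ 2 : PowerSeries ℚ) ≠ 0 := by
    intro h
    have := congrArg (PowerSeries.coeff 0) h
    simp [pu] at this
  apply mul_right_cancel₀ hne
  linear_combination hm

def den3 {R : Type*} [CommRing R] (q : R) : R := (1-q^2)^2*(1-q^3)^2*(1-q^4)*(1-q^6)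
lemma den3_aeval {S : Type*} [CommRing S] [Algebra ℚ S] (q : S) :
    Polynomial.aeval q (den3 (Polynomial.X : Polynomial ℚ)) = den3 q := by
  simp only [den3, map_sub, map_one, Polynomial.aeval_X, map_pow, map_mul]
lemma num3_aeval {S : Type*} [CommRing S] [Algebra ℚ S] (q : S) :
    Polynomial.aeval q (cNum3 (Polynomial.X : Polynomial ℚ)) = cNum3 q := by
  have := cNum3_map (Polynomial.aeval (R := ℚ) q : Polynomial ℚ →+* S) Polynomial.X
  rw [RingHom.coe_coe, Polynomial.aeval_X] at this
  exact this
lemma cancel3 {R : Type*} [CommRing R] (G z : R)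
   (hm : G * ((1 - z ^ 2) * (1 - (z ^ 2) ^ 2)) * den3 (z ^ 2) = cNum3 (z ^ 2)) :
   G * (1 + (z ^ 2) ^ 3) *
    ((1 - z ^ 4) ^ 3 * (1 - z ^ 6) ^ 3 * (1 - z ^ 8)) * (1 - z ^ 2) * (1 - z ^ 6) =
      (1 + 3 * z ^ 8 + z ^ 10 + 3 * z ^ 12 + z ^ 20) * (1 - z ^ 2) * (1 - z ^ 6) := by
  have e1 : (1 + 3 * z ^ 8 + z ^ 10 + 3 * z ^ 12 + z ^ 20) * (1 - z ^ 2) * (1 - z ^ 6) =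
    cNum3 (z ^ 2) * (1 - z ^ 6) := by unfold cNum3; ring
  rw [e1, ← hm, den3]
  ring

lemma final3 : dg ((tv - sv) * (gen w3 * (1 + sv ^ 3 * tv ^ 3))) *
    ((1 - pu ^ 4) ^ 3 * (1 - pu ^ 6) ^ 3 * (1 - pu ^ 8)) =
      1 + 3 * pu ^ 8 + pu ^ 10 + 3 * pu ^ 12 + pu ^ 20 := by
  have hg := gen_prod w3 w3_ne
  have hp : ∏ i, (1 - sv ^ (w3 i).1 * tv ^ (w3 i).2) =
      (1 - sv ^ 3) * ((1 - sv) * ((1 - sv ^ 2) * ((1 - tv) * ((1 - sv * tv) * ((1 - sv ^ 2 * tv) *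
      ((1 - tv ^ 2) * ((1 - sv * tv ^ 2) * ((1 - (sv * tv) ^ 2) * (1 - tv ^ 3))))))))) := by
    simp [Fin.prod_univ_succ, w3, mul_pow]
  rw [hp] at hg
  have hU : (gen w3 * ((1 - sv * tv) * (1 - (sv * tv)^2))) *
      (((1-sv)*(1-sv^2)*(1-sv^2*tv)*(1-sv^3)) * ((1-tv)*(1-tv^2)*(1-sv*tv^2)*(1-tv^3))) = 1 := by
    refine Eq.trans ?_ hg; ac_rfl
  have hm := dg_main (Den := den3 Polynomial.X) (Num := cNum3 Polynomial.X) hU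
    (A := cA3 sv (sv * tv)) (B := cB3 tv (sv * tv))
    (by rw [den3_aeval, num3_aeval]; exact cert3 sv tv) cA3_mem cB3_mem
    (by
      refine divS1 (a := 1) (b := 0) (D := 1 - sv) (by omega) (by omega) (by simp) ?_
      refine divS1 (a := 2) (b := 0) (D := 1 - sv^2) (by omega) (by omega) (by simp) ?_
      refine divS1 (a := 2) (b := 1) (D := 1 - sv^2*tv) (by omega) (by omega) (by simp) ?_
      refine divS1 (a := 3) (b := 0) (D := 1 - sv^3) (by omega) (by omega) (by simp) ?_
      convert coneS.one_mem using 1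
      refine Eq.trans ?_ hU; ac_rfl)
    (by
      refine divT1 (a := 0) (b := 1) (D := 1 - tv) (by omega) (by omega) (by simp) ?_
      refine divT1 (a := 0) (b := 2) (D := 1 - tv^2) (by omega) (by omega) (by simp) ?_
      refine divT1 (a := 1) (b := 2) (D := 1 - sv*tv^2) (by omega) (by omega) (by simp) ?_
      refine divT1 (a := 0) (b := 3) (D := 1 - tv^3) (by omega) (by omega) (by simp) ?_
      convert coneT.one_mem using 1
      refine Eq.trans ?_ hU; ac_rfl)
  have h3 : dg ((tv - sv) * (gen w3 * ((1 - sv * tv) * (1 - (sv * tv)^2)))) =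
      dg ((tv - sv) * gen w3) * ((1 - pu ^ 2) * (1 - (pu ^ 2) ^ 2)) := by
    have := dg_aeval ((tv - sv) * gen w3) ((1 - Polynomial.X) * (1 - Polynomial.X ^ 2))
    simp only [map_sub, map_one, Polynomial.aeval_X, map_mul, map_pow] at this
    rw [← this, mul_assoc]
  have h4 : dg ((tv - sv) * (gen w3 * (1 + sv ^ 3 * tv ^ 3))) =
      dg ((tv - sv) * gen w3) * (1 + (pu ^ 2) ^ 3) := by
    have := dg_aeval ((tv - sv) * gen w3) (1 + Polynomial.X ^ 3)
    simp only [map_add, map_one, Polynomial.aeval_X, map_pow, mul_pow] at this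
    rw [← this, mul_assoc]
  rw [h3] at hm
  rw [h4]
  rw [den3_aeval, num3_aeval] at hm
  have hne : (1 - pu ^ 2 : PowerSeries ℚ) ≠ 0 := by
    intro h
    have := congrArg (PowerSeries.coeff 0) h
    simp [pu] at this
  apply mul_right_cancel₀ hne
  have hne : (1 - pu ^ 6 : PowerSeries ℚ) ≠ 0 := by
    intro h
    have := congrArg (PowerSeries.coeff 0) h
    simp [pu] at this
  apply mul_right_cancel₀ hne
  exact cancel3 _ _ hm

section PC
variable {K : Type*} [Field K]

lemma finrank_of_basis {σ ι V : Type*} (w : σ → ℤ × ℤ) [AddCommGroup V] [Module K V] (B : Module.Basis ι K V)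
    (Θ : V →ₗ[K] MvPolynomial σ K) (hΘ : Function.Injective Θ) (R : Submodule K (MvPolynomial σ K))
    (hR : LinearMap.range Θ = R) (deg : ι → ℤ × ℤ) (hdeg : ∀ i, (Θ (B i)).IsWeightedHomogeneous w (deg i))
    (d : ℤ × ℤ) (hf : Finite {i // deg i = d}) :
    FiniteDimensional K ↥(R ⊓ weightedHomogeneousSubmodule K w d) ∧
    Module.finrank K ↥(R ⊓ weightedHomogeneousSubmodule K w d) = Nat.card {i // deg i = d} := by
  have hsp : R ⊓ weightedHomogeneousSubmodule K w d =
      Submodule.span K (Set.range fun i : {i // deg i = d} => Θ (B i)) := by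
    apply le_antisymm
    · rintro f ⟨h1, h2⟩
      have h2 : f.IsWeightedHomogeneous w d := h2
      rw [← hR] at h1
      obtain ⟨v, rfl⟩ := h1
      rw [← h2.weightedHomogeneousComponent_same]
      have hv := B.linearCombination_repr v
      rw [← hv, Finsupp.linearCombination_apply, Finsupp.sum, map_sum, map_sum]
      refine Submodule.sum_mem _ fun i _ => ?_
      rw [map_smul, map_smul]
      apply Submodule.smul_mem
      by_cases hi : deg i = d
      · rw [IsWeightedHomogeneous.weightedHomogeneousComponent_same (hi ▸ hdeg i)]
        exact Submodule.subset_span ⟨⟨i, hi⟩, rfl⟩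
      · rw [(hdeg i).weightedHomogeneousComponent_ne _ (Ne.symm hi)]
        exact Submodule.zero_mem _
    · rw [Submodule.span_le]
      rintro _ ⟨⟨i, rfl⟩, rfl⟩
      exact ⟨hR ▸ LinearMap.mem_range_self _ _, hdeg i⟩
  have hli : LinearIndependent K (fun i : {i // deg i = d} => Θ (B i)) := by
    have := B.linearIndependent.map' Θ (LinearMap.ker_eq_bot.2 hΘ)
    exact this.comp _ Subtype.val_injective
  rw [hsp]
  have := Fintype.ofFinite {i // deg i = d}
  refine ⟨FiniteDimensional.span_of_finite K (Set.finite_range _), ?_⟩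
  rw [finrank_span_eq_card hli, Nat.card_eq_fintype_card]

def cZ (r : ℕ × ℕ) : ℤ × ℤ := (r.1, r.2)
lemma cZ_inj {r s : ℕ × ℕ} : cZ r = cZ s ↔ r = s := by
  simp [cZ, Prod.ext_iff]
lemma cZ_add (r s : ℕ × ℕ) : cZ (r + s) = cZ r + cZ s := by simp [cZ]
lemma cZ_sum {ι : Type*} (s : Finset ι) (f : ι → ℕ × ℕ) : cZ (∑ i ∈ s, f i) = ∑ i ∈ s, cZ (f i) := by
  ext <;> simp [cZ, Prod.fst_sum, Prod.snd_sum]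
lemma cZ_smul (k : ℕ) (r : ℕ × ℕ) : cZ (k • r) = k • cZ r := by ext <;> simp [cZ]

lemma aeval_mon_wt {σ : Type*} {N : ℕ} (w : σ → ℤ × ℤ) (T : Fin N → MvPolynomial σ K) (wT : Fin N → ℕ × ℕ)
    (hT : ∀ i, (T i).IsWeightedHomogeneous w (cZ (wT i))) (e : Fin N →₀ ℕ) :
    (aeval T (monomial e (1 : K))).IsWeightedHomogeneous w (cZ (∑ i, e i • wT i)) := by
  rw [aeval_monomial, map_one, one_mul, Finsupp.prod_fintype _ _ (by simp), cZ_sum]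
  refine IsWeightedHomogeneous.prod _ _ _ fun i _ => ?_
  rw [cZ_smul]
  exact (hT i).pow _

lemma cnt_eq {N : ℕ} (wT : Fin N → ℕ × ℕ) (r : ℕ × ℕ) :
    Nat.card {e : Fin N →₀ ℕ // ∑ i, e i • wT i = r} = cnt wT r := by
  rw [cnt]
  exact Nat.card_congr (Finsupp.equivFunOnFinite.subtypeEquiv fun e => by simp)

lemma cZ_neg {r : ℕ × ℕ} {d : ℤ × ℤ} (h : ∀ s, cZ s ≠ d) : cZ r ≠ d := h r

lemma assemble [CharZero K] {n : ℕ} (Φ : SS) (hfin : ∀ p q : ℕ, FiniteDimensional K (Rb K n p q))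
    (h : ∀ p q : ℕ, (Module.finrank K (Rb K n p q) : ℚ) = cf p q Φ) :
    sharpPS K n = dg ((tv - sv) * Φ) := by
  have hneg : ∀ p q : ℤ, (p < 0 ∨ q < 0) → Rb K n p q = ⊥ := by
    intro p q hpq
    rw [eq_bot_iff]
    rintro f ⟨_, hf⟩
    exact wt_neg hf hpq
  have hfin' : ∀ p q : ℤ, FiniteDimensional K (Rb K n p q) := by
    intro p q
    by_cases hpq : p < 0 ∨ q < 0
    · rw [hneg p q hpq]; infer_instance
    · have := hfin p.toNat q.toNat
      rwa [Int.toNat_of_nonneg (by omega), Int.toNat_of_nonneg (by omega)] at this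
  ext k
  simp only [sharpPS, dg, LinearMap.coe_mk, AddHom.coe_mk, PowerSeries.coeff_mk]
  split_ifs with hk
  · obtain ⟨m, rfl⟩ := hk
    have e1 : (m + m) / 2 = m := by omega
    rw [e1, ← two_mul]
    have h1 := sharpDim_even hfin' m
    have h2 : cf m (m + 1) ((tv - sv) * Φ) = cf m m Φ - if 1 ≤ m then cf (m - 1) (m + 1) Φ else 0 := by
      have h3 := cf_mul_mon m (m + 1) 0 1 Φ
      have h4 := cf_mul_mon m (m + 1) 1 0 Φ
      simp only [pow_zero, pow_one, one_mul, mul_one] at h3 h4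
      rw [mul_comm, mul_sub, cf_sub, h3, h4]
      simp
    rw [h2, ← h, ← h1]
    split_ifs with hm
    · rw [← h]
      have e3 : ((m - 1 : ℕ) : ℤ) = m - 1 := by omega
      rw [e3]; push_cast; ring
    · have : m = 0 := by omega
      subst this
      rw [hneg _ _ (Or.inl (by simp))]
      simp
  · obtain ⟨m, rfl⟩ := Nat.not_even_iff_odd.1 hk
    rw [sharpDim_odd]; simp

lemma assemble2 [CharZero K] (T : Fin 5 → MvPolynomial (MatVar 2) K)
    (hw : ∀ i, (T i).IsWeightedHomogeneous (wt 2) (cZ (w2 i)))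
    (hinj : Function.Injective (aeval T : MvPolynomial (Fin 5) K →ₐ[K] _))
    (hT : ∀ f, IsMatInvariant f ↔ ∃ α : MvPolynomial (Fin 5) K, f = aeval T α) :
    sharpPS K 2 * (1 - pu ^ 4) ^ 2 = 1 := by
  have key : ∀ p q : ℕ, FiniteDimensional K (Rb K 2 p q) ∧
      (Module.finrank K (Rb K 2 p q) : ℚ) = cf p q (gen w2) := by
    intro p q
    have e : ∀ i : Fin 5 →₀ ℕ, cZ (∑ j, i j • w2 j) = ((p, q) : ℤ × ℤ) ↔ (∑ j, i j • w2 j) = (p, q) :=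
      fun i => cZ_inj (s := (p, q))
    have hfi : Finite {i : Fin 5 →₀ ℕ // cZ (∑ j, i j • w2 j) = ((p, q) : ℤ × ℤ)} := by
      have := cnt_finite w2 w2_ne (p, q)
      exact Finite.of_equiv _ (Finsupp.equivFunOnFinite.subtypeEquiv (p := fun i => cZ (∑ j, i j • w2 j) =
        ((p, q) : ℤ × ℤ)) (q := fun i => (∑ j, i j • w2 j) = (p, q)) fun i => e i).symm
    have := finrank_of_basis (wt 2) (basisMonomials (Fin 5) K) (aeval T).toLinearMap hinj (Rinv K 2)
      (by ext f; exact ⟨fun ⟨α, h⟩ => (hT f).2 ⟨α, h.symm⟩, fun h => by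
            obtain ⟨α, h⟩ := (hT f).1 h; exact ⟨α, h.symm⟩⟩)
      (fun e => cZ (∑ i, e i • w2 i)) (fun e => by
        rw [coe_basisMonomials]; exact aeval_mon_wt _ T w2 hw e) (p, q) hfi
    refine ⟨this.1, ?_⟩
    rw [Rb, this.2, cf_gen, ← cnt_eq]
    simp only [e]
  rw [assemble (gen w2) (fun p q => (key p q).1) (fun p q => (key p q).2)]
  exact final2

lemma assemble3 [CharZero K] (T : Fin 10 → MvPolynomial (MatVar 3) K) (u : MvPolynomial (MatVar 3) K)
    (hw : ∀ i, (T i).IsWeightedHomogeneous (wt 3) (cZ (w3 i)))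
    (hu : u.IsWeightedHomogeneous (wt 3) (cZ (3, 3)))
    (hinj : ∀ α β : MvPolynomial (Fin 10) K, aeval T α + aeval T β * u = 0 → α = 0 ∧ β = 0)
    (hT : ∀ f, IsMatInvariant f ↔ ∃ α β : MvPolynomial (Fin 10) K, f = aeval T α + aeval T β * u) :
    sharpPS K 3 * ((1 - pu ^ 4) ^ 3 * (1 - pu ^ 6) ^ 3 * (1 - pu ^ 8)) =
      1 + 3 * pu ^ 8 + pu ^ 10 + 3 * pu ^ 12 + pu ^ 20 := by
  let Θ : MvPolynomial (Fin 10) K × MvPolynomial (Fin 10) K →ₗ[K] MvPolynomial (MatVar 3) K :=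
    LinearMap.coprod (aeval T).toLinearMap (LinearMap.mulRight K u ∘ₗ (aeval T).toLinearMap)
  have hΘ : ∀ x, Θ x = aeval T x.1 + aeval T x.2 * u := fun x => by simp [Θ]
  have hΘi : Function.Injective Θ := by
    rw [← LinearMap.ker_eq_bot, LinearMap.ker_eq_bot']
    intro x hx
    rw [hΘ] at hx
    exact Prod.ext (hinj _ _ hx).1 (hinj _ _ hx).2
  let deg : (Fin 10 →₀ ℕ) ⊕ (Fin 10 →₀ ℕ) → ℕ × ℕ :=
    Sum.elim (fun e => ∑ i, e i • w3 i) (fun e => ∑ i, e i • w3 i + (3, 3))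
  have hfi0 : ∀ r, Finite {i : Fin 10 →₀ ℕ // (∑ j, i j • w3 j) = r} := fun r => by
    have := cnt_finite w3 w3_ne r
    exact Finite.of_equiv _ (Finsupp.equivFunOnFinite.subtypeEquiv (p := fun i => (∑ j, i j • w3 j) =
        r) (q := fun i => (∑ j, i j • w3 j) = r) fun i => Iff.rfl).symm
  have hcard : ∀ p q : ℕ, Finite {i // deg i = (p, q)} ∧
      (Nat.card {i // deg i = (p, q)} : ℚ) = cf p q (gen w3 * (1 + sv ^ 3 * tv ^ 3)) := by
    intro p q
    rw [mul_add, mul_one, cf_add, cf_mul_mon, cf_gen, cf_gen]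
    have E := Equiv.subtypeSum (p := fun i => deg i = (p, q))
    by_cases h3 : 3 ≤ p ∧ 3 ≤ q
    · have hr : ∀ e : Fin 10 →₀ ℕ, deg (Sum.inr e) = (p, q) ↔ ∑ i, e i • w3 i = (p - 3, q - 3) := by
        intro e
        simp only [deg, Sum.elim_inr, Prod.ext_iff, Prod.fst_add, Prod.snd_add]
        omega
      have E2 := E.trans (Equiv.sumCongr (Equiv.refl _) (Equiv.subtypeEquivRight hr))
      have := hfi0 (p - 3, q - 3)
      have : Finite {e : Fin 10 →₀ ℕ // deg (Sum.inl e) = (p, q)} := hfi0 (p, q)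
      refine ⟨Finite.of_equiv _ E2.symm, ?_⟩
      rw [if_pos h3, Nat.card_congr E2, Nat.card_sum, cnt_eq, ← cnt_eq w3 (p, q)]
      push_cast
      rfl
    · have : IsEmpty {e : Fin 10 →₀ ℕ // deg (Sum.inr e) = (p, q)} := by
        refine ⟨fun ⟨e, he⟩ => h3 ?_⟩
        simp only [deg, Sum.elim_inr, Prod.ext_iff, Prod.fst_add, Prod.snd_add] at he
        omega
      have E2 := E.trans (Equiv.sumEmpty _ _)
      have : Finite {e : Fin 10 →₀ ℕ // deg (Sum.inl e) = (p, q)} := hfi0 (p, q)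
      refine ⟨Finite.of_equiv _ E2.symm, ?_⟩
      rw [if_neg h3, Nat.card_congr E2, ← cnt_eq w3 (p, q), add_zero]
      rfl
  have key : ∀ p q : ℕ, FiniteDimensional K (Rb K 3 p q) ∧
      (Module.finrank K (Rb K 3 p q) : ℚ) = cf p q (gen w3 * (1 + sv ^ 3 * tv ^ 3)) := by
    intro p q
    have e : ∀ i, cZ (deg i) = ((p, q) : ℤ × ℤ) ↔ deg i = (p, q) :=
      fun i => cZ_inj (s := (p, q))
    have hfi : Finite {i // cZ (deg i) = ((p, q) : ℤ × ℤ)} := by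
      simp only [e]; exact (hcard p q).1
    have := finrank_of_basis (wt 3) ((basisMonomials (Fin 10) K).prod (basisMonomials (Fin 10) K))
      Θ hΘi (Rinv K 3)
      (by ext f; exact ⟨fun ⟨α, h⟩ => (hT f).2 ⟨α.1, α.2, by rw [← hΘ, h]⟩, fun h => by
            obtain ⟨α, β, h⟩ := (hT f).1 h; exact ⟨(α, β), by rw [hΘ, h]⟩⟩)
      (fun i => cZ (deg i)) (fun e => by
        rw [hΘ]
        rcases e with e | e
        · simpa [deg] using aeval_mon_wt _ T w3 hw e
        · have := (aeval_mon_wt _ T w3 hw e).mul hu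
          rw [← cZ_add] at this
          simpa [deg] using this) (p, q) hfi
    refine ⟨this.1, ?_⟩
    rw [Rb, this.2, ← (hcard p q).2]
    simp only [e]
  rw [assemble _ (fun p q => (key p q).1) (fun p q => (key p q).2)]
  exact final3
end PC

section PE1

def tf2 {R : Type*} [CommRing R] (A B : Matrix (Fin 2) (Fin 2) R) : Fin 5 → R :=
  ![(A * A).trace, A.trace, B.trace, (A * B).trace, (B * B).trace]
def tf3 {R : Type*} [CommRing R] (A B : Matrix (Fin 3) (Fin 3) R) : Fin 10 → R :=
  ![(A * A * A).trace, A.trace, (A * A).trace, B.trace, (A * B).trace, (A * A * B).trace,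
    (B * B).trace, (A * (B * B)).trace, (A * A * (B * B)).trace, (B * B * B).trace]
def uf3 {R : Type*} [CommRing R] (A B : Matrix (Fin 3) (Fin 3) R) : R :=
  ((A * B - B * A) * (A * B - B * A) * (A * B - B * A)).trace

lemma tracemap {n : ℕ} {R S : Type*} [CommRing R] [CommRing S] (f : R →+* S)
    (A : Matrix (Fin n) (Fin n) R) : (A.map f).trace = f A.trace := by
  simp [Matrix.trace]

lemma tf2_map {R S : Type*} [CommRing R] [CommRing S] (f : R →+* S) (A B : Matrix (Fin 2) (Fin 2) R)
    (i) : tf2 (A.map f) (B.map f) i = f (tf2 A B i) := by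
  fin_cases i <;> simp [tf2, ← tracemap, Matrix.map_mul]
lemma tf3_map {R S : Type*} [CommRing R] [CommRing S] (f : R →+* S) (A B : Matrix (Fin 3) (Fin 3) R)
    (i) : tf3 (A.map f) (B.map f) i = f (tf3 A B i) := by
  fin_cases i <;> simp [tf3, ← tracemap, Matrix.map_mul]
lemma uf3_map {R S : Type*} [CommRing R] [CommRing S] (f : R →+* S) (A B : Matrix (Fin 3) (Fin 3) R) :
    uf3 (A.map f) (B.map f) = f (uf3 A B) := by
  simp [uf3, ← tracemap, Matrix.map_mul, Matrix.map_sub]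

lemma conjmul {n : ℕ} {R : Type*} [CommRing R] {g h : Matrix (Fin n) (Fin n) R} (hg : h * g = 1)
    (A B : Matrix (Fin n) (Fin n) R) : (g * A * h) * (g * B * h) = g * (A * B) * h := by
  calc (g * A * h) * (g * B * h) = g * A * (h * g) * B * h := by simp only [mul_assoc]
    _ = _ := by rw [hg]; simp only [mul_assoc, one_mul]
lemma conj_trace {n : ℕ} {R : Type*} [CommRing R] {g h : Matrix (Fin n) (Fin n) R} (hg : h * g = 1)
    (A : Matrix (Fin n) (Fin n) R) : (g * A * h).trace = A.trace := by
  rw [Matrix.trace_mul_comm, ← mul_assoc, hg, one_mul]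

lemma tf2_conj {R : Type*} [CommRing R] {g h : Matrix (Fin 2) (Fin 2) R} (hg : h * g = 1)
    (A B : Matrix (Fin 2) (Fin 2) R) : tf2 (g * A * h) (g * B * h) = tf2 A B := by
  simp only [tf2, conjmul hg, conj_trace hg]
lemma tf3_conj {R : Type*} [CommRing R] {g h : Matrix (Fin 3) (Fin 3) R} (hg : h * g = 1)
    (A B : Matrix (Fin 3) (Fin 3) R) : tf3 (g * A * h) (g * B * h) = tf3 A B := by
  simp only [tf3, conjmul hg, conj_trace hg]
lemma uf3_conj {R : Type*} [CommRing R] {g h : Matrix (Fin 3) (Fin 3) R} (hg : h * g = 1)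
    (A B : Matrix (Fin 3) (Fin 3) R) : uf3 (g * A * h) (g * B * h) = uf3 A B := by
  have e : g * (A * B) * h - g * (B * A) * h = g * (A * B - B * A) * h := by
    rw [mul_sub, sub_mul]
  simp only [uf3, conjmul hg, e, conj_trace hg]

variable (K : Type*) [Field K] (n : ℕ)
def gX : Matrix (Fin n) (Fin n) (MvPolynomial (MatVar n) K) := Matrix.of fun i j => X (Sum.inl (i, j))
def gY : Matrix (Fin n) (Fin n) (MvPolynomial (MatVar n) K) := Matrix.of fun i j => X (Sum.inr (i, j))
def T2 (i : Fin 5) : MvPolynomial (MatVar 2) K := tf2 (gX K 2) (gY K 2) i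
def T3 (i : Fin 10) : MvPolynomial (MatVar 3) K := tf3 (gX K 3) (gY K 3) i
def U3 : MvPolynomial (MatVar 3) K := uf3 (gX K 3) (gY K 3)

variable {K n} {L : Type*} [Field L] [Algebra K L]
lemma gX_map (A B : Matrix (Fin n) (Fin n) L) :
    (gX K n).map (aeval (pairSub A B) : _ →ₐ[K] L).toRingHom = A := by
  ext i j; simp [gX, pairSub]
lemma gY_map (A B : Matrix (Fin n) (Fin n) L) :
    (gY K n).map (aeval (pairSub A B) : _ →ₐ[K] L).toRingHom = B := by
  ext i j; simp [gY, pairSub]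
lemma T2_aeval (A B : Matrix (Fin 2) (Fin 2) L) (i) : aeval (pairSub A B) (T2 K i) = tf2 A B i := by
  have := tf2_map (aeval (pairSub A B) : _ →ₐ[K] L).toRingHom (gX K 2) (gY K 2) i
  rw [gX_map, gY_map] at this
  exact this.symm
lemma T3_aeval (A B : Matrix (Fin 3) (Fin 3) L) (i) : aeval (pairSub A B) (T3 K i) = tf3 A B i := by
  have := tf3_map (aeval (pairSub A B) : _ →ₐ[K] L).toRingHom (gX K 3) (gY K 3) i
  rw [gX_map, gY_map] at this
  exact this.symm
lemma U3_aeval (A B : Matrix (Fin 3) (Fin 3) L) : aeval (pairSub A B) (U3 K) = uf3 A B := by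
  have := uf3_map (aeval (pairSub A B) : _ →ₐ[K] L).toRingHom (gX K 3) (gY K 3)
  rw [gX_map, gY_map] at this
  exact this.symm

lemma aeval_T2 (A B : Matrix (Fin 2) (Fin 2) L) (α : MvPolynomial (Fin 5) K) :
    aeval (pairSub A B) (aeval (T2 K) α) = aeval (tf2 A B) α := by
  have : aeval (tf2 A B) = (aeval (pairSub A B) : _ →ₐ[K] L).comp (aeval (T2 K)) := by
    ext i; simp [T2_aeval]
  rw [this]; rfl
lemma aeval_T3 (A B : Matrix (Fin 3) (Fin 3) L) (α : MvPolynomial (Fin 10) K) :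
    aeval (pairSub A B) (aeval (T3 K) α) = aeval (tf3 A B) α := by
  have : aeval (tf3 A B) = (aeval (pairSub A B) : _ →ₐ[K] L).comp (aeval (T3 K)) := by
    ext i; simp [T3_aeval]
  rw [this]; rfl

/-- entries are weighted homogeneous -/
def MatH (A : Matrix (Fin n) (Fin n) (MvPolynomial (MatVar n) K)) (d : ℤ × ℤ) : Prop :=
  ∀ i j, (A i j).IsWeightedHomogeneous (wt n) d
lemma MatH_X : MatH (gX K n) (1, 0) := fun i j => isWeightedHomogeneous_X K (wt n) (Sum.inl (i, j))
lemma MatH_Y : MatH (gY K n) (0, 1) := fun i j => isWeightedHomogeneous_X K (wt n) (Sum.inr (i, j))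
lemma MatH.mul {A B : Matrix (Fin n) (Fin n) (MvPolynomial (MatVar n) K)} {d e : ℤ × ℤ}
    (hA : MatH A d) (hB : MatH B e) : MatH (A * B) (d + e) := fun i j => by
  rw [Matrix.mul_apply]
  exact IsWeightedHomogeneous.sum _ _ _ fun k _ => (hA i k).mul (hB k j)
lemma MatH.sub {A B : Matrix (Fin n) (Fin n) (MvPolynomial (MatVar n) K)} {d : ℤ × ℤ}
    (hA : MatH A d) (hB : MatH B d) : MatH (A - B) d := fun i j =>
  (weightedHomogeneousSubmodule K (wt n) d).sub_mem (hA i j) (hB i j)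
lemma MatH.trace {A : Matrix (Fin n) (Fin n) (MvPolynomial (MatVar n) K)} {d e : ℤ × ℤ}
    (hA : MatH A d) (h : d = e) : A.trace.IsWeightedHomogeneous (wt n) e := by
  subst h
  exact IsWeightedHomogeneous.sum _ _ _ fun k _ => hA k k

lemma T2_wt (i) : (T2 K i).IsWeightedHomogeneous (wt 2) (cZ (w2 i)) := by
  have x := MatH_X (K := K) (n := 2)
  have y := MatH_Y (K := K) (n := 2)
  fin_cases i
  · exact (x.mul x).trace (by simp [cZ, w2])
  · exact (x).trace (by simp [cZ, w2])
  · exact (y).trace (by simp [cZ, w2])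
  · exact (x.mul y).trace (by simp [cZ, w2])
  · exact (y.mul y).trace (by simp [cZ, w2])
lemma T3_wt (i) : (T3 K i).IsWeightedHomogeneous (wt 3) (cZ (w3 i)) := by
  have x := MatH_X (K := K) (n := 3)
  have y := MatH_Y (K := K) (n := 3)
  fin_cases i
  · exact ((x.mul x).mul x).trace (by simp [cZ, w3])
  · exact (x).trace (by simp [cZ, w3])
  · exact (x.mul x).trace (by simp [cZ, w3])
  · exact (y).trace (by simp [cZ, w3])
  · exact (x.mul y).trace (by simp [cZ, w3])
  · exact ((x.mul x).mul y).trace (by simp [cZ, w3])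
  · exact (y.mul y).trace (by simp [cZ, w3])
  · exact (x.mul (y.mul y)).trace (by simp [cZ, w3])
  · exact ((x.mul x).mul (y.mul y)).trace (by simp [cZ, w3])
  · exact ((y.mul y).mul y).trace (by simp [cZ, w3])
lemma U3_wt : (U3 K).IsWeightedHomogeneous (wt 3) (cZ (3, 3)) := by
  have x := MatH_X (K := K) (n := 3)
  have y := MatH_Y (K := K) (n := 3)
  have z : MatH (gX K 3 * gY K 3 - gY K 3 * gX K 3) (1, 1) := by
    apply MatH.sub
    · simpa using x.mul y
    · simpa using y.mul x
  exact ((z.mul z).mul z).trace (by simp [cZ])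

section descent

variable (K n) in
abbrev RG := MvPolynomial ((Fin n × Fin n) ⊕ MatVar n) K
variable (K n) in
def ggG : Matrix (Fin n) (Fin n) (RG K n) := Matrix.of fun i j => X (Sum.inl (i, j))
variable (K n) in
def ggx : Matrix (Fin n) (Fin n) (RG K n) := Matrix.of fun i j => X (Sum.inr (Sum.inl (i, j)))
variable (K n) in
def ggy : Matrix (Fin n) (Fin n) (RG K n) := Matrix.of fun i j => X (Sum.inr (Sum.inr (i, j)))
def ggp (f : MvPolynomial (MatVar n) K) : RG K n :=
  (ggG K n).det * (aeval (pairSub (ggG K n * ggx K n * (ggG K n).adjugate)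
      (ggG K n * ggy K n * (ggG K n).adjugate)) f -
    aeval (pairSub ((ggG K n).det • ggx K n) ((ggG K n).det • ggy K n)) f)

lemma ggp_map (f : MvPolynomial (MatVar n) K) {M : Type*} [Field M] [Algebra K M]
    (g A B : Matrix (Fin n) (Fin n) M) :
      aeval (Sum.elim (fun ij : Fin n × Fin n => g ij.1 ij.2) (pairSub A B)) (ggp f) =
      g.det * (aeval (pairSub (g * A * g.adjugate) (g * B * g.adjugate)) f -
    aeval (pairSub (g.det • A) (g.det • B)) f) := by
  let φ : RG K n →ₐ[K] M := aeval (Sum.elim (fun ij : Fin n × Fin n => g ij.1 ij.2) (pairSub A B))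
  have hX : ∀ i, φ (X i) = (Sum.elim (fun ij : Fin n × Fin n => g ij.1 ij.2) (pairSub A B)) i :=
    fun i => aeval_X _ _
  have hG : (ggG K n).map φ = g := by ext i j; exact hX _
  have hx : (ggx K n).map φ = A := by ext i j; exact hX _
  have hy : (ggy K n).map φ = B := by ext i j; exact hX _
  have hd : φ (ggG K n).det = g.det := by
    rw [← hG]; exact RingHom.map_det φ.toRingHom _
  have had : (ggG K n).adjugate.map φ = g.adjugate := by
    rw [← hG]; exact RingHom.map_adjugate φ.toRingHom _
  have h1 : ∀ P Q : Matrix (Fin n) (Fin n) (RG K n), φ (aeval (pairSub P Q) f) =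
      aeval (pairSub (P.map φ) (Q.map φ)) f := by
    intro P Q
    have : (aeval (pairSub (P.map φ) (Q.map φ)) : _ →ₐ[K] M) = φ.comp (aeval (pairSub P Q)) := by
      ext i; rcases i with i | i <;> simp [pairSub]
    rw [this]; rfl
  change φ (ggp f) = _
  simp only [ggp, map_mul, map_sub, h1, hd, Matrix.map_mul, hG, hx, hy, had]
  congr 5
  · ext i j; simp [hd, ← hx]
  · ext i j; simp [hd, ← hy]

variable [Infinite K]
/-- invariance over extension fields -/
lemma inv_ext {f : MvPolynomial (MatVar n) K} (hf : IsMatInvariant f) :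
    IsMatInvariant (map (algebraMap K L) f) := by
  have hp : ggp f = 0 := by
    apply MvPolynomial.funext
    intro v
    rw [map_zero]
    obtain ⟨A, B, hAB⟩ := pair_surj (v ∘ Sum.inr)
    let g : Matrix (Fin n) (Fin n) K := Matrix.of fun i j => v (Sum.inl (i, j))
    have hv : v = Sum.elim (fun ij => g ij.1 ij.2) (pairSub A B) := by
      rw [← hAB]; funext i; rcases i with i | i <;> rfl
    rw [hv]
    have h := ggp_map f g A B
    rw [← coe_aeval_eq_eval]
    refine h.trans ?_
    by_cases hg : g.det = 0
    · rw [hg, zero_mul]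
    · have hu : IsUnit g.det := isUnit_iff_ne_zero.2 hg
      let a : GL (Fin n) K := Matrix.nonsingInvUnit g hu
      have h2 := hf a (g.det • A) (g.det • B)
      have h3 : ∀ C : Matrix (Fin n) (Fin n) K, (a : Matrix (Fin n) (Fin n) K) * (g.det • C) *
          ((a⁻¹ : GL (Fin n) K) : Matrix (Fin n) (Fin n) K) = g * C * g.adjugate := by
        intro C
        have : ((a⁻¹ : GL (Fin n) K) : Matrix (Fin n) (Fin n) K) = g⁻¹ := rfl
        rw [this, Matrix.inv_def]
        change g * (g.det • C) * _ = _
        simp only [Matrix.mul_smul, Matrix.smul_mul, smul_smul]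
        rw [Ring.inverse_mul_cancel _ hu, one_smul]
      rw [h3, h3] at h2
      have h2b : aeval (pairSub (g * A * g.adjugate) (g * B * g.adjugate)) f =
        aeval (pairSub (g.det • A) (g.det • B)) f := h2
      rw [h2b, sub_self, mul_zero]
  intro a A B
  let g : Matrix (Fin n) (Fin n) L := a
  have hu : IsUnit g.det := a.isUnit.map Matrix.detMonoidHom
  have hne : g.det ≠ 0 := hu.ne_zero
  have h := ggp_map f g (g.det⁻¹ • A) (g.det⁻¹ • B)
  rw [hp, map_zero, eq_comm, mul_eq_zero, or_iff_right hne, sub_eq_zero] at h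
  have h3 : ∀ C : Matrix (Fin n) (Fin n) L, g * (g.det⁻¹ • C) * g.adjugate =
      (a : Matrix (Fin n) (Fin n) L) * C * ((a⁻¹ : GL (Fin n) L) : Matrix (Fin n) (Fin n) L) := by
    intro C
    have : ((a⁻¹ : GL (Fin n) L) : Matrix (Fin n) (Fin n) L) = g⁻¹ := by
      rw [Matrix.coe_units_inv]
    rw [this, Matrix.inv_def, Ring.inverse_eq_inv']
    simp only [Matrix.mul_smul, Matrix.smul_mul]
    rfl
  rw [h3, h3, smul_smul, smul_smul, mul_inv_cancel₀ hne, one_smul, one_smul] at h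
  rw [eval_map, eval_map]
  exact h
end descent
end PE1

section PE2
variable {L : Type*} [Field L]

/-- evaluation of polynomials in eigenvalues with coefficients polynomials in invariants -/
def ev2 {n m : ℕ} (t : Fin m → L) (v : Fin n → L) :
    MvPolynomial (Fin n) (MvPolynomial (Fin m) L) →+* L := eval₂Hom (eval t) v

abbrev TF (L : Type*) [Field L] (n m : ℕ) :=
  Matrix (Fin n) (Fin n) L → Matrix (Fin n) (Fin n) L → Fin m → L

def slB {n m : ℕ} (t : TF L n m) (D : MvPolynomial (Fin n) (MvPolynomial (Fin m) L)) :
    Subalgebra L ((Fin n → L) × Matrix (Fin n) (Fin n) L → L) where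
  carrier := {F | ∃ (N : ℕ) (H : MvPolynomial (Fin n) (MvPolynomial (Fin m) L)), ∀ v y,
    ev2 (t (diagonal v) y) v D ^ N * F (v, y) = ev2 (t (diagonal v) y) v H}
  mul_mem' := by
    rintro F G ⟨N, H, h⟩ ⟨M, I, i⟩
    refine ⟨N + M, H * I, fun v y => ?_⟩
    rw [map_mul, ← h, ← i, Pi.mul_apply]; ring
  add_mem' := by
    rintro F G ⟨N, H, h⟩ ⟨M, I, i⟩
    refine ⟨N + M, D ^ M * H + D ^ N * I, fun v y => ?_⟩
    rw [map_add, map_mul, map_mul, ← h, ← i, Pi.add_apply, map_pow, map_pow]; ring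
  algebraMap_mem' := by
    intro r
    exact ⟨0, C (C r), fun v y => by simp [ev2]⟩

lemma slB_cancel {n m : ℕ} {t : TF L n m} {D : MvPolynomial (Fin n) (MvPolynomial (Fin m) L)}
    {F : (Fin n → L) × Matrix (Fin n) (Fin n) L → L} (N : ℕ)
    (H : MvPolynomial (Fin n) (MvPolynomial (Fin m) L))
    (h : ∀ v y, ev2 (t (diagonal v) y) v D ^ N * F (v, y) = ev2 (t (diagonal v) y) v H) :
    F ∈ slB t D := ⟨N, H, h⟩

def ConjInv {n m : ℕ} (t : TF L n m) : Prop :=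
  ∀ g h : Matrix (Fin n) (Fin n) L, h * g = 1 → ∀ A B, t (g * A * h) (g * B * h) = t A B

lemma IsMatInvariant.conj {n : ℕ} {f : MvPolynomial (MatVar n) L} (hf : IsMatInvariant f)
    (g h : Matrix (Fin n) (Fin n) L) (hg : h * g = 1) (A B) :
    eval (pairSub (g * A * h) (g * B * h)) f = eval (pairSub A B) f := by
  have hg2 : g * h = 1 := mul_eq_one_comm.1 hg
  exact hf ⟨g, h, hg2, hg⟩ A B

lemma perm_conj {n : ℕ} (σ : Equiv.Perm (Fin n)) (A : Matrix (Fin n) (Fin n) L) :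
    A.submatrix σ σ = (1 : Matrix (Fin n) (Fin n) L).submatrix σ id * A *
      (1 : Matrix (Fin n) (Fin n) L).submatrix id σ := by
  ext i j
  simp [Matrix.mul_apply, Matrix.one_apply]

lemma perm_inv {n : ℕ} (σ : Equiv.Perm (Fin n)) :
    (1 : Matrix (Fin n) (Fin n) L).submatrix id σ * (1 : Matrix (Fin n) (Fin n) L).submatrix σ id = 1 := by
  ext i j
  have : (∑ k, (1 : Matrix (Fin n) (Fin n) L) i (σ k) * (1 : Matrix (Fin n) (Fin n) L) (σ k) j) =
      ∑ k, (1 : Matrix (Fin n) (Fin n) L) i k * (1 : Matrix (Fin n) (Fin n) L) k j :=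
    Equiv.sum_comp σ (fun k => (1 : Matrix (Fin n) (Fin n) L) i k * (1 : Matrix (Fin n) (Fin n) L) k j)
  rw [← Matrix.mul_apply, one_mul] at this
  exact this

theorem slice_thm [CharZero L] {n m : ℕ} (t : TF L n m) (ht : ConjInv t)
    {f : MvPolynomial (MatVar n) L} (hf : IsMatInvariant f)
    (D : MvPolynomial (Fin n) (MvPolynomial (Fin m) L)) (DS : MvPolynomial (Fin m) L)
    (hD : ∀ v y, eval (t (diagonal v) y) DS = ev2 (t (diagonal v) y) v D ^ 2)
    (hB : (fun z : (Fin n → L) × Matrix (Fin n) (Fin n) L => eval (pairSub (diagonal z.1) z.2) f)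
      ∈ slB t D)
    (hdiag : ∀ A B, eval (t A B) DS ≠ 0 → ∃ (v : Fin n → L) (g h : Matrix (Fin n) (Fin n) L),
      h * g = 1 ∧ A = g * diagonal v * h)
    (E : Fin n → MvPolynomial (Fin m) L)
    (hE : ∀ v y i, eval (t (diagonal v) y) (E i) = eval v (esymm (Fin n) L (i + 1))) :
    ∃ (M : ℕ) (H : MvPolynomial (Fin m) L), ∀ A B,
      eval (t A B) DS ^ M * eval (pairSub A B) f = eval (t A B) H := by
  obtain ⟨N, H, hH⟩ := hB
  have h1 : ∀ v y, eval (t (diagonal v) y) DS ^ N * eval (pairSub (diagonal v) y) f =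
      ev2 (t (diagonal v) y) v (D ^ N * H) := by
    intro v y
    have := hH v y
    simp only at this
    rw [map_mul, ← this, hD, map_pow]; ring
  have h2 : ∀ (σ : Equiv.Perm (Fin n)) v y,
      eval (t (diagonal v) y) DS ^ N * eval (pairSub (diagonal v) y) f =
      ev2 (t (diagonal v) y) v (rename σ (D ^ N * H)) := by
    intro σ v y
    have h3 := h1 (v ∘ σ) (y.submatrix σ σ)
    have e : diagonal (v ∘ σ) = (diagonal v).submatrix σ σ :=
      (Matrix.submatrix_diagonal_equiv v σ).symm
    rw [e, perm_conj σ y, perm_conj σ (diagonal v), ht _ _ (perm_inv σ),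
      hf.conj _ _ (perm_inv σ)] at h3
    rw [h3, ev2, ev2, coe_eval₂Hom, coe_eval₂Hom, eval₂_rename]
  set S := ∑ σ : Equiv.Perm (Fin n), rename σ (D ^ N * H) with hS
  have hsym : S.IsSymmetric := by
    intro τ
    rw [hS, map_sum]
    refine Fintype.sum_equiv (Equiv.mulLeft τ) _ _ fun σ => ?_
    rw [rename_rename]; rfl
  have h4 : ∀ v y, (n.factorial : L) * (eval (t (diagonal v) y) DS ^ N * eval (pairSub (diagonal v) y) f) =
      ev2 (t (diagonal v) y) v S := by
    intro v y
    rw [hS, map_sum, Finset.sum_congr rfl fun σ _ => (h2 σ v y).symm]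
    simp [Fintype.card_perm]
  obtain ⟨Q, hQ⟩ := (esymmAlgEquiv (Fin n) (MvPolynomial (Fin m) L) (Fintype.card_fin n)).surjective ⟨S, hsym⟩
  have hQ2 : S = aeval (fun i : Fin n ↦ esymm (Fin n) (MvPolynomial (Fin m) L) (i + 1)) Q := by
    have := congrArg Subtype.val hQ
    rw [esymmAlgEquiv_apply, esymmAlgHom_apply] at this
    exact this.symm
  have h5 : ∀ v y, ev2 (t (diagonal v) y) v S = eval (t (diagonal v) y) (aeval E Q) := by
    intro v y
    rw [hQ2]
    have : (ev2 (t (diagonal v) y) v).comp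
        (aeval (fun i : Fin n ↦ esymm (Fin n) (MvPolynomial (Fin m) L) (i + 1)) :
          _ →ₐ[MvPolynomial (Fin m) L] _).toRingHom =
        (eval (t (diagonal v) y)).comp (aeval E : _ →ₐ[MvPolynomial (Fin m) L] _).toRingHom := by
      apply MvPolynomial.ringHom_ext
      · intro r; simp [ev2]
      · intro i
        simp [hE, ev2, esymm]
    exact congrArg (fun φ => φ Q) this
  refine ⟨N + 1, C ((n.factorial : L)⁻¹) * DS * aeval E Q, fun A B => ?_⟩
  by_cases h0 : eval (t A B) DS = 0
  · simp [h0]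
  obtain ⟨v, g, h, hg, rfl⟩ := hdiag A B h0
  have hB : B = g * (h * B * g) * h := by
    have hg2 : g * h = 1 := mul_eq_one_comm.1 hg
    calc B = (g * h) * B * (g * h) := by rw [hg2, one_mul, mul_one]
      _ = _ := by simp only [mul_assoc]
  rw [hB, ht _ _ hg, hf.conj _ _ hg]
  have h6 := (h4 v (h * B * g)).trans (h5 v (h * B * g))
  rw [map_mul, map_mul, ← h6, eval_C]
  have : (n.factorial : L) ≠ 0 := Nat.cast_ne_zero.2 n.factorial_ne_zero
  field_simp
  ring
end PE2

section PE3
variable {L : Type*} [Field L]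

lemma coeff_scale {σ : Type*} [Fintype σ] (c : σ → L) (p : MvPolynomial σ L) (m : σ →₀ ℕ) :
    coeff m (aeval (fun i => C (c i) * X i) p) = (∏ i, c i ^ m i) * coeff m p := by
  classical
  induction p using MvPolynomial.induction_on' with
  | add p q hp hq => simp only [map_add, coeff_add, hp, hq, mul_add]
  | monomial s a =>
    have : aeval (fun i => C (c i) * X i) (monomial s a) = C (∏ i, c i ^ s i) * monomial s a := by
      rw [aeval_monomial, Finsupp.prod_fintype _ _ (by simp)]
      simp only [mul_pow, Finset.prod_mul_distrib]
      rw [monomial_eq, Finsupp.prod_fintype _ _ (by simp), map_prod]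
      simp only [map_pow, algebraMap_eq]; ring
    rw [this, coeff_C_mul, coeff_monomial]
    split_ifs with h
    · rw [h]
    · simp

lemma scale_supp [Infinite L] {σ : Type*} [Fintype σ] (c : σ → L) (p : MvPolynomial σ L)
    (h : ∀ x, eval (fun i => c i * x i) p = eval x p) (m : σ →₀ ℕ) (hm : m ∈ p.support) :
    ∏ i, c i ^ m i = 1 := by
  have e : aeval (fun i => C (c i) * X i) p = p := by
    apply MvPolynomial.funext
    intro x
    rw [← h x]
    have : (eval x).comp (aeval (fun i => C (c i) * X i) : _ →ₐ[L] _).toRingHom =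
        eval (fun i => c i * x i) := by
      apply MvPolynomial.ringHom_ext <;> simp
    exact congrArg (fun φ => φ p) this
  have h2 := coeff_scale c p m
  rw [e] at h2
  have h3 : coeff m p ≠ 0 := mem_support_iff.1 hm
  exact mul_right_cancel₀ h3 (by rw [← h2, one_mul])

def slicePt {R : Type*} [CommRing R] {n : ℕ} (x : Fin n ⊕ (Fin n × Fin n) → R) : MatVar n → R :=
  pairSub (diagonal fun i => x (Sum.inl i)) (Matrix.of fun i j => x (Sum.inr (i, j)))

def sliceP {n : ℕ} (f : MvPolynomial (MatVar n) L) : MvPolynomial (Fin n ⊕ (Fin n × Fin n)) L :=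
  aeval (slicePt X) f
lemma sliceP_eval {n : ℕ} (f : MvPolynomial (MatVar n) L) (x) :
    eval x (sliceP f) = eval (slicePt x) f := by
  have : (eval x).comp (aeval (slicePt X) : _ →ₐ[L] _).toRingHom =
        eval (slicePt x) := by
      apply MvPolynomial.ringHom_ext
      · simp
      · rintro (⟨i, j⟩ | ⟨i, j⟩)
        · by_cases h : i = j
          · subst h; simp [slicePt, pairSub]
          · simp [slicePt, pairSub, h]
        · simp [slicePt, pairSub]
  exact congrArg (fun φ => φ f) this

lemma torus_bal [CharZero L] {n : ℕ} {f : MvPolynomial (MatVar n) L} (hf : IsMatInvariant f)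
    (m : Fin n ⊕ (Fin n × Fin n) →₀ ℕ) (hm : m ∈ (sliceP f).support) (k : Fin n) :
    ∑ j, m (Sum.inr (k, j)) = ∑ i, m (Sum.inr (i, k)) := by
  let w : Fin n → L := fun i => if i = k then 2 else 1
  have hw : ∀ i, w i ≠ 0 := by intro i; simp only [w]; split_ifs <;> simp
  let c : Fin n ⊕ (Fin n × Fin n) → L := Sum.elim (fun _ => 1) (fun ij => w ij.1 * (w ij.2)⁻¹)
  have h1 := scale_supp c (sliceP f) (by
    intro x
    rw [sliceP_eval, sliceP_eval]
    have hg : diagonal (fun i => (w i)⁻¹) * diagonal w = 1 := by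
      rw [diagonal_mul_diagonal, ← diagonal_one]; congr 1; funext i; simp [hw]
    have := hf.conj _ _ hg (diagonal fun i => x (Sum.inl i)) (Matrix.of fun i j => x (Sum.inr (i, j)))
    rw [slicePt, slicePt, ← this]
    congr 3
    · rw [diagonal_mul_diagonal, diagonal_mul_diagonal]; congr 1; funext i
      simp only [c, Sum.elim_inl]; field_simp [hw]
    · ext i j
      simp only [of_apply, mul_diagonal, diagonal_mul, c, Sum.elim_inr]; ring) m hm
  rw [Fintype.prod_sum_type, Fintype.prod_prod_type] at h1
  simp only [c, Sum.elim_inl, one_pow, Finset.prod_const_one, one_mul, Sum.elim_inr, mul_pow,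
    Finset.prod_mul_distrib, inv_pow, Finset.prod_inv_distrib] at h1
  rw [Finset.prod_comm (f := fun x x_1 => (w x_1 ^ m (Sum.inr (x, x_1))))] at h1
  simp only [Finset.prod_pow_eq_pow_sum] at h1
  simp only [w, ite_pow, one_pow, Finset.prod_ite_eq', Finset.mem_univ, if_true] at h1
  have h2 : (2 : L) ^ (∑ i, m (Sum.inr (i, k))) ≠ 0 := pow_ne_zero _ two_ne_zero
  rw [mul_inv_eq_one₀ h2] at h1
  have h3 : (2 : ℕ) ^ (∑ i, m (Sum.inr (k, i))) = 2 ^ (∑ i, m (Sum.inr (i, k))) := by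
    exact_mod_cast h1
  exact Nat.pow_right_injective le_rfl h3

lemma slB_mem [CharZero L] {n k : ℕ} (t : TF L n k) (D : MvPolynomial (Fin n) (MvPolynomial (Fin k) L))
    {f : MvPolynomial (MatVar n) L} (hf : IsMatInvariant f)
    (hm : ∀ m : Fin n × Fin n → ℕ, (∀ k, ∑ j, m (k, j) = ∑ i, m (i, k)) →
      (fun z : (Fin n → L) × Matrix (Fin n) (Fin n) L => ∏ ij, z.2 ij.1 ij.2 ^ m ij) ∈ slB t D) :
    (fun z : (Fin n → L) × Matrix (Fin n) (Fin n) L => eval (pairSub (diagonal z.1) z.2) f)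
      ∈ slB t D := by
  have hv : ∀ i, (fun z : (Fin n → L) × Matrix (Fin n) (Fin n) L => z.1 i) ∈ slB t D :=
    fun i => ⟨0, X i, fun v y => by simp [ev2]⟩
  have e : (fun z : (Fin n → L) × Matrix (Fin n) (Fin n) L => eval (pairSub (diagonal z.1) z.2) f) =
      ∑ m ∈ (sliceP f).support, (coeff m (sliceP f)) •
        ((∏ i, (fun z : (Fin n → L) × Matrix (Fin n) (Fin n) L => z.1 i) ^ m (Sum.inl i)) *
        (fun z : (Fin n → L) × Matrix (Fin n) (Fin n) L => ∏ ij, z.2 ij.1 ij.2 ^ m (Sum.inr ij))) := by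
    funext z
    have := sliceP_eval f (Sum.elim z.1 fun ij => z.2 ij.1 ij.2)
    have e2 : slicePt (Sum.elim z.1 fun ij => z.2 ij.1 ij.2) = pairSub (diagonal z.1) z.2 := rfl
    rw [← e2, ← this, eval_eq', Finset.sum_apply]
    refine Finset.sum_congr rfl fun m _ => ?_
    simp [Fintype.prod_sum_type]
  rw [e]
  refine Subalgebra.sum_mem _ fun m hms => Subalgebra.smul_mem _ (Subalgebra.mul_mem _ ?_ ?_) _
  · exact Subalgebra.prod_mem _ fun i _ => Subalgebra.pow_mem _ (hv i) _
  · exact hm (fun ij => m (Sum.inr ij)) (torus_bal hf m hms)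
end PE3

section PE4
variable {L : Type*} [Field L] [CharZero L]

lemma one_var_zero {F Q : Polynomial L} (hQ : Q ≠ 0)
    (h : ∀ s, Q.eval s ≠ 0 → F.eval s = 0) : F = 0 := by
  have : F * Q = 0 := by
    apply Polynomial.funext
    intro s
    rw [Polynomial.eval_mul, Polynomial.eval_zero]
    by_cases hs : Q.eval s = 0
    · rw [hs, mul_zero]
    · rw [h s hs, zero_mul]
  exact (mul_eq_zero.1 this).resolve_right hQ

lemma mv_zero {σ : Type*} {F Q : MvPolynomial σ L} (hQ : Q ≠ 0)
    (h : ∀ s, eval s Q ≠ 0 → eval s F = 0) : F = 0 := by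
  have : F * Q = 0 := by
    apply MvPolynomial.funext
    intro s
    rw [map_mul, map_zero]
    by_cases hs : eval s Q = 0
    · rw [hs, mul_zero]
    · rw [h s hs, zero_mul]
  exact (mul_eq_zero.1 this).resolve_right hQ

lemma divLemma {k : ℕ} (DS : MvPolynomial (Fin (k + 1)) L) (κ : L) (hκ : κ ≠ 0)
    (Dm : Polynomial (MvPolynomial (Fin k) L)) (hm : Dm.Monic)
    (hDS : finSuccEquiv L k DS = Polynomial.C (C κ) * Dm)
    (q : MvPolynomial (Fin k) L) (hq : q ≠ 0) (g : MvPolynomial (Fin (k + 1)) L)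
    (h : ∀ s, eval s q ≠ 0 → ∃ Z : Finset L, Dm.natDegree ≤ Z.card ∧
      ∀ z ∈ Z, eval (Fin.cons z s : Fin (k + 1) → L) DS = 0 ∧ eval (Fin.cons z s : Fin (k + 1) → L) g = 0) :
    ∃ h, g = DS * h := by
  set G := finSuccEquiv L k g with hG
  have hr : G %ₘ Dm = 0 := by
    ext1 i
    rw [Polynomial.coeff_zero]
    refine mv_zero hq fun s hs => ?_
    obtain ⟨Z, hZ, hz⟩ := h s hs
    have h0 : (G %ₘ Dm).map (eval s) = 0 := by
      apply Polynomial.eq_zero_of_degree_lt_of_eval_finset_eq_zero Z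
      · calc ((G %ₘ Dm).map (eval s)).degree ≤ (G %ₘ Dm).degree := Polynomial.degree_map_le
          _ < Dm.degree := Polynomial.degree_modByMonic_lt _ hm
          _ ≤ Z.card := by
            rw [Polynomial.degree_eq_natDegree hm.ne_zero]; exact_mod_cast hZ
      · intro z hzZ
        obtain ⟨h1, h2⟩ := hz z hzZ
        rw [eval_eq_eval_mv_eval', hDS] at h1
        rw [eval_eq_eval_mv_eval', ← hG, ← Polynomial.modByMonic_add_div G Dm] at h2
        simp only [Polynomial.map_mul, Polynomial.map_C, Polynomial.eval_mul, Polynomial.eval_C,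
          eval_C, Polynomial.map_add, Polynomial.eval_add] at h1 h2
        rw [(mul_eq_zero.1 h1).resolve_left hκ, zero_mul, add_zero] at h2
        exact h2
    have := congrArg (fun p => Polynomial.coeff p i) h0
    simpa using this
  have hG2 : G = Dm * (G /ₘ Dm) := by
    conv_lhs => rw [← Polynomial.modByMonic_add_div G Dm, hr, zero_add]
  refine ⟨(finSuccEquiv L k).symm (Polynomial.C (C κ⁻¹) * (G /ₘ Dm)), ?_⟩
  apply (finSuccEquiv L k).injective
  rw [map_mul, AlgEquiv.apply_symm_apply, hDS, ← hG]
  conv_lhs => rw [hG2]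
  have : (Polynomial.C (C κ) * Polynomial.C (C κ⁻¹) : Polynomial (MvPolynomial (Fin k) L)) = 1 := by
    rw [← Polynomial.C_mul, ← C_mul, mul_inv_cancel₀ hκ, C_1, Polynomial.C_1]
  calc _ = 1 * (Dm * (G /ₘ Dm)) := by rw [one_mul]
    _ = _ := by rw [← this]; ring

lemma infdiv_zero {σ : Type*} (DS : MvPolynomial σ L) (a b : σ → L) (ha : eval a DS = 0)
    (hb : eval b DS ≠ 0) (P : MvPolynomial σ L → Prop)
    (hP : ∀ g, P g → ∃ h, g = DS * h ∧ P h) (g) (hg : P g) : g = 0 := by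
  have hpos : 1 ≤ DS.totalDegree := by
    by_contra hc
    have : DS.totalDegree = 0 := by omega
    rw [totalDegree_eq_zero_iff_eq_C] at this
    rw [this, eval_C] at ha hb
    exact hb ha
  have : ∀ N g, g.totalDegree ≤ N → P g → g = 0 := by
    intro N
    induction N with
    | zero =>
      intro g hN hg
      obtain ⟨h, rfl, hh⟩ := hP g hg
      by_contra hne
      rw [mul_eq_zero, not_or] at hne
      rw [totalDegree_mul_of_isDomain hne.1 hne.2] at hN
      omega
    | succ N ih =>
      intro g hN hg
      obtain ⟨h, rfl, hh⟩ := hP g hg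
      by_contra hne
      rw [mul_eq_zero, not_or] at hne
      rw [totalDegree_mul_of_isDomain hne.1 hne.2] at hN
      exact hne.2 (ih h (by omega) hh)
  exact this _ g le_rfl hg

lemma diag_of_eig {n : ℕ} (A : Matrix (Fin n) (Fin n) L) (v : Fin n → L) (hv : Function.Injective v)
    (h : ∀ i, (A - v i • (1 : Matrix (Fin n) (Fin n) L)).det = 0) :
    ∃ (g h : Matrix (Fin n) (Fin n) L), h * g = 1 ∧ A = g * diagonal v * h := by
  have h1 : ∀ i, ∃ x, x ≠ 0 ∧ (A - v i • (1 : Matrix (Fin n) (Fin n) L)) *ᵥ x = 0 := fun i =>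
    Matrix.exists_mulVec_eq_zero_iff.2 (h i)
  choose x hx0 hx using h1
  have hx2 : ∀ i, A *ᵥ x i = v i • x i := by
    intro i
    have := hx i
    rw [Matrix.sub_mulVec, Matrix.smul_mulVec, Matrix.one_mulVec, sub_eq_zero] at this
    exact this
  have hli : LinearIndependent L x :=
    Module.End.eigenvectors_linearIndependent' (Matrix.toLin' A) v hv x fun i =>
      ⟨Module.End.mem_eigenspace_iff.2 (by rw [Matrix.toLin'_apply, hx2]), hx0 i⟩
  let g : Matrix (Fin n) (Fin n) L := Matrix.of fun i j => x j i
  have hg : IsUnit g := Matrix.linearIndependent_cols_iff_isUnit.1 hli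
  have hAg : A * g = g * diagonal v := by
    ext i j
    have := congrFun (hx2 j) i
    rw [Matrix.mul_diagonal, Matrix.mul_apply]
    simp only [Matrix.mulVec, dotProduct, Pi.smul_apply, smul_eq_mul] at this
    simp only [g, of_apply]
    rw [this, mul_comm]
  have hd : IsUnit g.det := (Matrix.isUnit_iff_isUnit_det g).1 hg
  refine ⟨g, g⁻¹, Matrix.nonsing_inv_mul g hd, ?_⟩
  rw [← hAg, mul_assoc, Matrix.mul_nonsing_inv g hd, mul_one]

end PE4

section PE5
variable {L : Type*} [Field L] [CharZero L]

lemma eval_T2 (A B : Matrix (Fin 2) (Fin 2) L) (α : MvPolynomial (Fin 5) L) :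
    eval (pairSub A B) (aeval (T2 L) α) = eval (tf2 A B) α := aeval_T2 A B α

variable (L) in
def DS2 : MvPolynomial (Fin 5) L := C 2 * X 0 - X 1 ^ 2
lemma DS2_eval (A B : Matrix (Fin 2) (Fin 2) L) :
    eval (tf2 A B) (DS2 L) = 2 * (A * A).trace - A.trace ^ 2 := by
  simp [DS2, tf2]

lemma DS2_cancel {f : MvPolynomial (MatVar 2) L}
    (h : ∀ A B, eval (tf2 A B) (DS2 L) * eval (pairSub A B) f = 0) (A B) :
    eval (pairSub A B) f = 0 := by
  have h1 : aeval (T2 L) (DS2 L) * f = 0 := by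
    apply pair_funext
    intro A B
    rw [map_mul, eval_T2, h, map_zero]
  rcases mul_eq_zero.1 h1 with h2 | h2
  · exfalso
    have := eval_T2 (diagonal ![0, 1]) 0 (DS2 L)
    rw [h2, map_zero, DS2_eval] at this
    norm_num [Matrix.trace, Fin.sum_univ_two, Matrix.mul_apply] at this
  · rw [h2, map_zero]

lemma key2 (g : MvPolynomial (Fin 5) L)
    (h : ∀ A B, eval (tf2 A B) (DS2 L) = 0 → eval (tf2 A B) g = 0) : ∃ h, g = DS2 L * h := by
  refine divLemma (DS2 L) 2 two_ne_zero (Polynomial.X - Polynomial.C (C (1 / 2) * X 0 ^ 2))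
    (Polynomial.monic_X_sub_C _) ?_ (C 2 * X 2 - X 0 * X 1) ?_ g ?_
  · rw [DS2, map_sub, map_mul, map_pow, finSuccEquiv_X_zero]
    have : finSuccEquiv L 4 (X 1) = Polynomial.C (X 0) := finSuccEquiv_X_succ (j := (0 : Fin 4))
    have h2 : finSuccEquiv L 4 (C 2) = Polynomial.C (C 2) := by
      rw [← algebraMap_eq, AlgEquiv.commutes]; rfl
    rw [this, h2, mul_sub, ← Polynomial.C_mul, ← mul_assoc, ← C_mul]
    norm_num
  · intro h0
    have := congrArg (eval ![0, 0, 1, 0]) h0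
    simp at this
  · intro s hs
    have hs2 : 2 * s 2 - s 0 * s 1 ≠ 0 := by simpa using hs
    refine ⟨{s 0 ^ 2 / 2}, by rw [Polynomial.natDegree_X_sub_C]; simp, ?_⟩
    intro z hz
    rw [Finset.mem_singleton] at hz
    let a := s 0 / 2
    let b := s 2 - a * s 1
    have hb : b ≠ 0 := by
      intro hb
      apply hs2
      have : 2 * b = 2 * s 2 - s 0 * s 1 := by simp only [b, a]; ring
      rw [← this, hb, mul_zero]
    let A : Matrix (Fin 2) (Fin 2) L := !![a, 1; 0, a]
    let B : Matrix (Fin 2) (Fin 2) L := !![s 1, (s 3 - s 1 ^ 2) / (2 * b); b, 0]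
    have ht : (Fin.cons z s : Fin 5 → L) = tf2 A B := by
      funext i
      fin_cases i
      · simp [tf2, A, Matrix.trace_fin_two, hz, a, Matrix.mul_apply]; ring
      · simp [tf2, A, Matrix.trace_fin_two, a, Matrix.mul_apply]
      · simp [tf2, B, Matrix.trace_fin_two]; rfl
      · simp [tf2, A, B, Matrix.trace_fin_two, Matrix.mul_apply]
        change s 2 = _
        simp only [b]; ring
      · simp [tf2, A, B, Matrix.trace_fin_two, Matrix.mul_apply]
        change s 3 = _
        field_simp; ring
    have hD : eval (tf2 A B) (DS2 L) = 0 := by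
      rw [DS2_eval]
      simp [A, Matrix.trace_fin_two]; ring
    rw [ht]
    exact ⟨hD, h A B hD⟩

lemma indep2 (g : MvPolynomial (Fin 5) L) (h : ∀ A B, eval (tf2 A B) g = 0) : g = 0 := by
  refine infdiv_zero (DS2 L) 0 ![1, 0, 0, 0, 0] (by simp [DS2]) (by simp [DS2])
    (fun g => ∀ A B, eval (tf2 A B) g = 0) ?_ g h
  intro g hg
  obtain ⟨h, rfl⟩ := key2 g fun A B _ => hg A B
  refine ⟨h, rfl, fun A B => ?_⟩
  rw [← eval_T2]
  refine DS2_cancel (fun A B => ?_) A B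
  rw [eval_T2, ← map_mul]; exact hg A B

lemma slB2_bal (m : Fin 2 × Fin 2 → ℕ) (hm : ∀ k, ∑ j, m (k, j) = ∑ i, m (i, k)) :
      (fun z : (Fin 2 → L) × Matrix (Fin 2) (Fin 2) L => ∏ ij, z.2 ij.1 ij.2 ^ m ij) ∈
        slB tf2 (X 0 - X 1) := by
  have hy0 : (fun z : (Fin 2 → L) × Matrix (Fin 2) (Fin 2) L => z.2 0 0) ∈
        slB tf2 (X 0 - X 1) := by
    refine ⟨1, C (X 3) - X 1 * C (X 2), fun v y => ?_⟩
    simp [ev2, tf2, Matrix.trace_fin_two]; ring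
  have hy1 : (fun z : (Fin 2 → L) × Matrix (Fin 2) (Fin 2) L => z.2 1 1) ∈
        slB tf2 (X 0 - X 1) := by
    refine ⟨1, X 0 * C (X 2) - C (X 3), fun v y => ?_⟩
    simp [ev2, tf2, Matrix.trace_fin_two]; ring
  have hyy : (fun z : (Fin 2 → L) × Matrix (Fin 2) (Fin 2) L => (z.2 * z.2).trace) ∈
        slB tf2 (X 0 - X 1) := by
    refine ⟨0, C (X 4), fun v y => ?_⟩
    simp [ev2, tf2]
  have hp : (fun z : (Fin 2 → L) × Matrix (Fin 2) (Fin 2) L => z.2 0 1 * z.2 1 0) ∈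
        slB tf2 (X 0 - X 1) := by
    have : (fun z : (Fin 2 → L) × Matrix (Fin 2) (Fin 2) L => z.2 0 1 * z.2 1 0) =
        (1 / 2 : L) • ((fun z : (Fin 2 → L) × Matrix (Fin 2) (Fin 2) L => (z.2 * z.2).trace)
          - (fun z : (Fin 2 → L) × Matrix (Fin 2) (Fin 2) L => z.2 0 0) ^ 2
          - (fun z : (Fin 2 → L) × Matrix (Fin 2) (Fin 2) L => z.2 1 1) ^ 2) := by
      funext z
      simp [Matrix.trace_fin_two, Matrix.mul_apply]; ring
    rw [this]
    exact Subalgebra.smul_mem _ (Subalgebra.sub_mem _ (Subalgebra.sub_mem _ hyy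
      (Subalgebra.pow_mem _ hy0 _)) (Subalgebra.pow_mem _ hy1 _)) _
  have hb : m (0, 1) = m (1, 0) := by
    have := hm 0
    simp [Fin.sum_univ_two] at this
    omega
  have e : (fun z : (Fin 2 → L) × Matrix (Fin 2) (Fin 2) L => ∏ ij, z.2 ij.1 ij.2 ^ m ij) =
      (fun z : (Fin 2 → L) × Matrix (Fin 2) (Fin 2) L => z.2 0 0) ^ m (0, 0) *
      (fun z : (Fin 2 → L) × Matrix (Fin 2) (Fin 2) L => z.2 1 1) ^ m (1, 1) *
      (fun z : (Fin 2 → L) × Matrix (Fin 2) (Fin 2) L => z.2 0 1 * z.2 1 0) ^ m (0, 1) := by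
    funext z
    simp only [Fintype.prod_prod_type, Fin.prod_univ_two, Pi.mul_apply, Pi.pow_apply, ← hb, mul_pow]
    ring
  rw [e]
  exact Subalgebra.mul_mem _ (Subalgebra.mul_mem _ (Subalgebra.pow_mem _ hy0 _)
    (Subalgebra.pow_mem _ hy1 _)) (Subalgebra.pow_mem _ hp _)

variable [IsAlgClosed L]
lemma diag2 (A B : Matrix (Fin 2) (Fin 2) L) (h : eval (tf2 A B) (DS2 L) ≠ 0) :
    ∃ (v : Fin 2 → L) (g h : Matrix (Fin 2) (Fin 2) L), h * g = 1 ∧ A = g * diagonal v * h := by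
  obtain ⟨d, hd⟩ := IsAlgClosed.exists_pow_nat_eq (eval (tf2 A B) (DS2 L)) (n := 2) (by norm_num)
  have hd0 : d ≠ 0 := by rintro rfl; apply h; rw [← hd]; simp
  rw [DS2_eval] at hd
  refine ⟨![(A.trace + d) / 2, (A.trace - d) / 2], diag_of_eig A _ ?_ ?_⟩
  · have hne : (A.trace + d) / 2 ≠ (A.trace - d) / 2 := by
      intro he
      apply hd0
      linear_combination he
    intro i j hij
    fin_cases i <;> fin_cases j <;> simp_all
  · simp [Matrix.trace_fin_two, Matrix.mul_apply] at hd
    intro i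
    fin_cases i
    · simp [Matrix.det_fin_two, Matrix.trace_fin_two]
      linear_combination hd / 4
    · simp [Matrix.det_fin_two, Matrix.trace_fin_two]
      linear_combination hd / 4

theorem struct2 {f : MvPolynomial (MatVar 2) L} (hf : IsMatInvariant f) :
    ∃ α : MvPolynomial (Fin 5) L, ∀ A B, eval (pairSub A B) f = eval (tf2 A B) α := by
  obtain ⟨M, H, hH⟩ := slice_thm tf2 (fun g h hg A B => tf2_conj hg A B) hf (X 0 - X 1) (DS2 L)
    (by intro v y; rw [DS2_eval]; simp [ev2, Matrix.trace_fin_two]; ring)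
    (slB_mem _ _ hf slB2_bal) diag2 ![X 1, C (1 / 2) * (X 1 ^ 2 - X 0)]
    (by
      intro v y i
      fin_cases i
      · simp [tf2, esymm_one]
      · have : Finset.powersetCard 2 (Finset.univ : Finset (Fin 2)) = {Finset.univ} := by decide
        simp [tf2, esymm, Matrix.trace_fin_two, this]; ring)
  induction M generalizing H with
  | zero => exact ⟨H, fun A B => by simpa using hH A B⟩
  | succ M ih =>
    obtain ⟨h, rfl⟩ := key2 H fun A B h0 => by rw [← hH, h0]; simp
    refine ih h fun A B => ?_
    have := DS2_cancel (f := aeval (T2 L) (DS2 L) ^ M * f - aeval (T2 L) h) (fun A B => by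
      have := hH A B
      rw [map_sub, map_mul, map_pow, eval_T2, eval_T2]
      rw [map_mul] at this
      rw [mul_sub, ← this]; ring) A B
    rw [map_sub, map_mul, map_pow, eval_T2, eval_T2, sub_eq_zero] at this
    exact this
end PE5

section PE6
variable {L : Type*} [Field L] [CharZero L]

lemma eval_T3 (A B : Matrix (Fin 3) (Fin 3) L) (α : MvPolynomial (Fin 10) L) :
    eval (pairSub A B) (aeval (T3 L) α) = eval (tf3 A B) α := aeval_T3 A B α
lemma eval_U3 (A B : Matrix (Fin 3) (Fin 3) L) :
    eval (pairSub A B) (U3 L) = uf3 A B := U3_aeval A B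

/-- the discriminant in terms of power sums -/
def discp (p1 p2 p3 : L) : L := -3 * p3 ^ 2 + (-(4 / 3) * p1 ^ 3 + 6 * p1 * p2) * p3 +
  (-(1 / 6) * p1 ^ 6 + 3 / 2 * p1 ^ 4 * p2 - 7 / 2 * p1 ^ 2 * p2 ^ 2 + 1 / 2 * p2 ^ 3)
variable (L) in
def DS3 : MvPolynomial (Fin 10) L :=
  C (-3) * X 0 ^ 2 + (C (-(4 / 3)) * X 1 ^ 3 + C 6 * X 1 * X 2) * X 0 +
  (C (-(1 / 6)) * X 1 ^ 6 + C (3 / 2) * X 1 ^ 4 * X 2 - C (7 / 2) * X 1 ^ 2 * X 2 ^ 2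
    + C (1 / 2) * X 2 ^ 3)
lemma DS3_eval0 (s : Fin 10 → L) : eval s (DS3 L) = discp (s 1) (s 2) (s 0) := by
  simp only [DS3, discp, map_add, map_sub, map_mul, map_pow, eval_C, eval_X]
lemma DS3_eval (A B : Matrix (Fin 3) (Fin 3) L) :
    eval (tf3 A B) (DS3 L) = discp A.trace (A * A).trace (A * A * A).trace := DS3_eval0 _
lemma discp_roots (a b c : L) :
    discp (a + b + c) (a ^ 2 + b ^ 2 + c ^ 2) (a ^ 3 + b ^ 3 + c ^ 3) =
      ((a - b) * (b - c) * (c - a)) ^ 2 := by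
  unfold discp; field_simp; ring

lemma DS3_cancel {f : MvPolynomial (MatVar 3) L}
    (h : ∀ A B, eval (tf3 A B) (DS3 L) * eval (pairSub A B) f = 0) (A B) :
    eval (pairSub A B) f = 0 := by
  have h1 : aeval (T3 L) (DS3 L) * f = 0 := by
    apply pair_funext
    intro A B
    rw [map_mul, eval_T3, h, map_zero]
  rcases mul_eq_zero.1 h1 with h2 | h2
  · exfalso
    have := eval_T3 (diagonal ![0, 1, -1]) 0 (DS3 L)
    rw [h2, map_zero, DS3_eval] at this
    simp only [Matrix.trace_fin_three, diagonal_mul_diagonal, diagonal_apply_eq] at this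
    have e2 : (![0, 1, -1] : Fin 3 → L) 2 = -1 := rfl
    norm_num [discp, e2] at this
  · rw [h2, map_zero]

lemma cubic_roots [IsAlgClosed L] (p1 p2 p3 : L) : ∃ a b c : L, p1 = a + b + c ∧
    p2 = a ^ 2 + b ^ 2 + c ^ 2 ∧ p3 = a ^ 3 + b ^ 3 + c ^ 3 := by
  set e2 := (p1 ^ 2 - p2) / 2 with he2
  set e3 := (p1 ^ 3 - 3 * p1 * p2 + 2 * p3) / 6 with he3
  obtain ⟨a, ha⟩ := IsAlgClosed.exists_root
    (Polynomial.X ^ 3 - Polynomial.C p1 * Polynomial.X ^ 2 + Polynomial.C e2 * Polynomial.X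
      - Polynomial.C e3) (by
      have : (Polynomial.X ^ 3 - Polynomial.C p1 * Polynomial.X ^ 2 + Polynomial.C e2 * Polynomial.X
        - Polynomial.C e3 : Polynomial L).degree = 3 := by compute_degree!
      rw [this]; norm_num)
  simp only [Polynomial.IsRoot.def, Polynomial.eval_sub, Polynomial.eval_add, Polynomial.eval_mul,
    Polynomial.eval_pow, Polynomial.eval_X, Polynomial.eval_C] at ha
  obtain ⟨d, hd⟩ := IsAlgClosed.exists_pow_nat_eq ((p1 - a) ^ 2 - 4 * (e2 - a * (p1 - a)))
    (n := 2) (by norm_num)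
  refine ⟨a, (p1 - a + d) / 2, (p1 - a - d) / 2, by ring, ?_, ?_⟩
  · rw [he2] at hd
    linear_combination (-1 / 2) * hd
  · rw [he2] at hd ha
    rw [he3] at ha
    linear_combination (-3) * ha - (3 / 4) * (p1 - a) * hd

lemma diag3 [IsAlgClosed L] (A B : Matrix (Fin 3) (Fin 3) L) (h : eval (tf3 A B) (DS3 L) ≠ 0) :
    ∃ (v : Fin 3 → L) (g h : Matrix (Fin 3) (Fin 3) L), h * g = 1 ∧ A = g * diagonal v * h := by
  obtain ⟨a, b, c, h1, h2, h3⟩ := cubic_roots A.trace (A * A).trace (A * A * A).trace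
  rw [DS3_eval, h1, h2, h3, discp_roots] at h
  have key : ∀ z, (z - a) * (z - b) * (z - c) = 0 →
      (A - z • (1 : Matrix (Fin 3) (Fin 3) L)).det = 0 := by
    intro z hz
    have e : (A - z • (1 : Matrix (Fin 3) (Fin 3) L)).det =
      -(z ^ 3 - A.trace * z ^ 2 + (A.trace ^ 2 - (A * A).trace) / 2 * z -
      (A.trace ^ 3 - 3 * A.trace * (A * A).trace + 2 * (A * A * A).trace) / 6) := by
      simp [Matrix.det_fin_three, Matrix.trace_fin_three, Matrix.mul_apply, Fin.sum_univ_three]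
      field_simp
      ring
    rw [e, h1, h2, h3]
    linear_combination -hz
  have hab : a ≠ b := by rintro rfl; simp at h
  have hbc : b ≠ c := by rintro rfl; simp at h
  have hca : c ≠ a := by rintro rfl; simp at h
  refine ⟨![a, b, c], diag_of_eig A _ ?_ ?_⟩
  · intro i j hij
    fin_cases i <;> fin_cases j <;> simp_all
  · intro i
    apply key
    fin_cases i <;> simp

variable (L) in
def Dp (m : ℕ) : MvPolynomial (Fin 3) (MvPolynomial (Fin m) L) :=
  (X 0 - X 1) * (X 1 - X 2) * (X 2 - X 0)
lemma Dp_eval {m : ℕ} (t : Fin m → L) (v : Fin 3 → L) :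
    ev2 t v (Dp L m) = (v 0 - v 1) * (v 1 - v 2) * (v 2 - v 0) := by
  simp [ev2, Dp]

lemma slice3 [IsAlgClosed L] {m : ℕ} (t : TF L 3 m) (ht : ConjInv t) (ι : Fin 10 → Fin m)
    (hι : ∀ A B i, t A B (ι i) = tf3 A B i)
    {f : MvPolynomial (MatVar 3) L} (hf : IsMatInvariant f)
    (hB : (fun z : (Fin 3 → L) × Matrix (Fin 3) (Fin 3) L => eval (pairSub (diagonal z.1) z.2) f)
      ∈ slB t (Dp L m)) :
    ∃ (M : ℕ) (H : MvPolynomial (Fin m) L), ∀ A B,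
      eval (tf3 A B) (DS3 L) ^ M * eval (pairSub A B) f = eval (t A B) H := by
  have hren : ∀ A B P, eval (t A B) (rename ι P) = eval (tf3 A B) P := by
    intro A B P
    rw [eval_rename]
    congr 2
    funext i
    exact hι A B i
  obtain ⟨M, H, hH⟩ := slice_thm t ht hf (Dp L m) (rename ι (DS3 L))
    (by
      intro v y
      rw [hren, DS3_eval, Dp_eval, ← discp_roots]
      congr 1 <;> simp [Fin.sum_univ_three] <;> ring)
    hB (by intro A B; rw [hren]; exact diag3 A B)
    (fun i => rename ι (![X 1, C (1 / 2) * (X 1 ^ 2 - X 2),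
      C (1 / 6) * (X 1 ^ 3 - C 3 * X 1 * X 2 + C 2 * X 0)] i))
    (by
      intro v y i
      rw [hren]
      fin_cases i
      · simp [tf3, esymm_one]
      · have : Finset.powersetCard 2 (Finset.univ : Finset (Fin 3)) = {{0, 1}, {0, 2}, {1, 2}} := by decide
        have h2 : ({0, 1} : Finset (Fin 3)) ∉ ({{0, 2}, {1, 2}} : Finset (Finset (Fin 3))) := by decide
        have h3 : ({0, 2} : Finset (Fin 3)) ∉ ({{1, 2}} : Finset (Finset (Fin 3))) := by decide
        simp only [esymm, this, map_sum, map_prod, eval_X]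
        simp [Finset.sum_insert h2, Finset.sum_insert h3, tf3, Fin.sum_univ_three]; ring
      · have : Finset.powersetCard 3 (Finset.univ : Finset (Fin 3)) = {Finset.univ} := by decide
        simp [tf3, esymm, Fin.sum_univ_three, this, Fin.prod_univ_three]; ring)
  refine ⟨M, H, fun A B => ?_⟩
  rw [← hH, hren]

end PE6

section PE7
variable {L : Type*} [Field L] [CharZero L]

abbrev ZZ (L : Type*) := (Fin 3 → L) × Matrix (Fin 3) (Fin 3) L

lemma uf3_slice (v : Fin 3 → L) (y : Matrix (Fin 3) (Fin 3) L) :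
    uf3 (diagonal v) y = 3 * ((v 0 - v 1) * (v 1 - v 2) * (v 2 - v 0)) *
      (y 0 1 * y 1 2 * y 2 0 - y 0 2 * y 2 1 * y 1 0) := by
  have hZ : ∀ i j, (diagonal v * y - y * diagonal v) i j = (v i - v j) * y i j := by
    intro i j
    rw [Matrix.sub_apply, Matrix.diagonal_mul, Matrix.mul_diagonal]; ring
  unfold uf3
  generalize diagonal v * y - y * diagonal v = Z at hZ
  simp only [Matrix.trace_fin_three, Matrix.mul_apply, Fin.sum_univ_three, hZ]
  ring

section gens
variable {m : ℕ} (t : TF L 3 m) (ι : Fin 10 → Fin m)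
    (hι : ∀ A B i, t A B (ι i) = tf3 A B i)
include hι

lemma slB3_t (i : Fin 10) : (fun z : ZZ L => tf3 (diagonal z.1) z.2 i) ∈ slB t (Dp L m) :=
  ⟨0, C (X (ι i)), fun v y => by simp [ev2, hι]⟩

lemma slB3_v (i : Fin 3) : (fun z : ZZ L => z.1 i) ∈ slB t (Dp L m) :=
  ⟨0, X i, fun v y => by simp [ev2]⟩

lemma slB3_diag (w : Matrix (Fin 3) (Fin 3) L → Matrix (Fin 3) (Fin 3) L) (a b c : Fin 10)
    (ha : ∀ A B, tf3 (R := L) A B a = (w B).trace)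
    (hb : ∀ A B, tf3 (R := L) A B b = (A * w B).trace)
    (hc : ∀ A B, tf3 (R := L) A B c = (A * A * w B).trace) (i : Fin 3) :
    (fun z : ZZ L => w z.2 i i) ∈ slB t (Dp L m) := by
  fin_cases i
  · refine ⟨1, (X 2 - X 1) * (C (X (ι c)) - (X 1 + X 2) * C (X (ι b)) + X 1 * X 2 * C (X (ι a))),
      fun v y => ?_⟩
    rw [Dp_eval]
    simp only [ev2, coe_eval₂Hom, eval₂_mul, eval₂_sub, eval₂_add, eval₂_X, eval₂_C, eval_X, hι,
      ha, hb, hc]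
    simp [Matrix.trace_fin_three]; ring
  · refine ⟨1, (X 0 - X 2) * (C (X (ι c)) - (X 0 + X 2) * C (X (ι b)) + X 0 * X 2 * C (X (ι a))),
      fun v y => ?_⟩
    rw [Dp_eval]
    simp only [ev2, coe_eval₂Hom, eval₂_mul, eval₂_sub, eval₂_add, eval₂_X, eval₂_C, eval_X, hι,
      ha, hb, hc]
    simp [Matrix.trace_fin_three]; ring
  · refine ⟨1, (X 1 - X 0) * (C (X (ι c)) - (X 1 + X 0) * C (X (ι b)) + X 1 * X 0 * C (X (ι a))),
      fun v y => ?_⟩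
    rw [Dp_eval]
    simp only [ev2, coe_eval₂Hom, eval₂_mul, eval₂_sub, eval₂_add, eval₂_X, eval₂_C, eval_X, hι,
      ha, hb, hc]
    simp [Matrix.trace_fin_three]; ring

lemma slB3_y (i : Fin 3) : (fun z : ZZ L => z.2 i i) ∈ slB t (Dp L m) :=
  slB3_diag t ι hι (fun B => B) 3 4 5 (fun _ _ => rfl) (fun _ _ => rfl) (fun _ _ => rfl) i
lemma slB3_yy (i : Fin 3) : (fun z : ZZ L => (z.2 * z.2) i i) ∈ slB t (Dp L m) :=
  slB3_diag t ι hι (fun B => B * B) 6 7 8 (fun _ _ => rfl) (fun _ _ => rfl) (fun _ _ => rfl) i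

lemma slB3_p : (fun z : ZZ L => z.2 0 1 * z.2 1 0) ∈ slB t (Dp L m) ∧
    (fun z : ZZ L => z.2 1 2 * z.2 2 1) ∈ slB t (Dp L m) ∧
    (fun z : ZZ L => z.2 0 2 * z.2 2 0) ∈ slB t (Dp L m) := by
  have y := slB3_y t ι hι
  have yy := slB3_yy t ι hι
  have g : ∀ i j k : Fin 3, (1 / 2 : L) • ((fun z : ZZ L => (z.2 * z.2) i i) - (fun z : ZZ L => z.2 i i) ^ 2
      + ((fun z : ZZ L => (z.2 * z.2) j j) - (fun z : ZZ L => z.2 j j) ^ 2)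
      - ((fun z : ZZ L => (z.2 * z.2) k k) - (fun z : ZZ L => z.2 k k) ^ 2)) ∈ slB t (Dp L m) := by
    intro i j k
    have h1 : ∀ i, (fun z : ZZ L => (z.2 * z.2) i i) - (fun z : ZZ L => z.2 i i) ^ 2 ∈ slB t (Dp L m) :=
      fun i => Subalgebra.sub_mem _ (yy i) (Subalgebra.pow_mem _ (y i) _)
    exact Subalgebra.smul_mem _ (Subalgebra.sub_mem _ (Subalgebra.add_mem _ (h1 i) (h1 j)) (h1 k)) _
  refine ⟨?_, ?_, ?_⟩
  · convert g 0 1 2 using 1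
    funext z; simp [Matrix.mul_apply, Fin.sum_univ_three]; ring
  · convert g 1 2 0 using 1
    funext z; simp [Matrix.mul_apply, Fin.sum_univ_three]; ring
  · convert g 0 2 1 using 1
    funext z; simp [Matrix.mul_apply, Fin.sum_univ_three]; ring

lemma slB3_sig : (fun z : ZZ L => z.2 0 1 * z.2 1 2 * z.2 2 0 + z.2 0 2 * z.2 2 1 * z.2 1 0)
    ∈ slB t (Dp L m) := by
  have y := slB3_y t ι hι
  obtain ⟨p, q, r⟩ := slB3_p t ι hι
  have h9 := slB3_t t ι hι 9
  set y0 := (fun z : ZZ L => z.2 0 0) with hy0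
  set y1 := (fun z : ZZ L => z.2 1 1) with hy1
  set y2 := (fun z : ZZ L => z.2 2 2) with hy2
  set p' := (fun z : ZZ L => z.2 0 1 * z.2 1 0) with hp
  set q' := (fun z : ZZ L => z.2 1 2 * z.2 2 1) with hq
  set r' := (fun z : ZZ L => z.2 0 2 * z.2 2 0) with hr
  have e : (fun z : ZZ L => z.2 0 1 * z.2 1 2 * z.2 2 0 + z.2 0 2 * z.2 2 1 * z.2 1 0) =
      (1 / 3 : L) • ((fun z : ZZ L => tf3 (diagonal z.1) z.2 9) - (y0 ^ 3 + y1 ^ 3 + y2 ^ 3)) -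
        ((y0 + y1) * p' + (y1 + y2) * q' + (y0 + y2) * r') := by
    funext z
    simp [tf3, hy0, hy1, hy2, hp, hq, hr, Matrix.trace_fin_three, Matrix.mul_apply, Fin.sum_univ_three]
    ring
  rw [e]
  have a := Subalgebra.add_mem (slB t (Dp L m)) (Subalgebra.add_mem _ (Subalgebra.pow_mem _ (y 0) 3)
    (Subalgebra.pow_mem _ (y 1) 3)) (Subalgebra.pow_mem _ (y 2) 3)
  have b := Subalgebra.add_mem (slB t (Dp L m)) (Subalgebra.add_mem _
    (Subalgebra.mul_mem _ (Subalgebra.add_mem _ (y 0) (y 1)) p)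
    (Subalgebra.mul_mem _ (Subalgebra.add_mem _ (y 1) (y 2)) q))
    (Subalgebra.mul_mem _ (Subalgebra.add_mem _ (y 0) (y 2)) r)
  exact Subalgebra.sub_mem _ (Subalgebra.smul_mem _ (Subalgebra.sub_mem _ h9 a) _) b

lemma slB3_uu : (fun z : ZZ L => uf3 (diagonal z.1) z.2 ^ 2) ∈ slB t (Dp L m) := by
  obtain ⟨p, q, r⟩ := slB3_p t ι hι
  have σ := slB3_sig t ι hι
  have v := slB3_v t ι hι
  have d := Subalgebra.mul_mem _ (Subalgebra.mul_mem _ (Subalgebra.sub_mem _ (v 0) (v 1))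
    (Subalgebra.sub_mem _ (v 1) (v 2))) (Subalgebra.sub_mem _ (v 2) (v 0))
  have h := Subalgebra.smul_mem (slB t (Dp L m)) (Subalgebra.mul_mem _ (Subalgebra.pow_mem _ d 2)
    (Subalgebra.sub_mem _ (Subalgebra.pow_mem _ σ 2) (Subalgebra.smul_mem _
      (Subalgebra.mul_mem _ (Subalgebra.mul_mem _ p q) r) (4 : L)))) (9 : L)
  convert h using 1
  funext z
  rw [uf3_slice]
  simp; ring

lemma slB3_bal (hs : (fun z : ZZ L => z.2 0 1 * z.2 1 2 * z.2 2 0) ∈ slB t (Dp L m))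
    (hs' : (fun z : ZZ L => z.2 0 2 * z.2 2 1 * z.2 1 0) ∈ slB t (Dp L m))
    (e : Fin 3 × Fin 3 → ℕ) (he : ∀ k, ∑ j, e (k, j) = ∑ i, e (i, k)) :
    (fun z : ZZ L => ∏ ij, z.2 ij.1 ij.2 ^ e ij) ∈ slB t (Dp L m) := by
  have y := slB3_y t ι hι
  obtain ⟨p, q, r⟩ := slB3_p t ι hι
  have h0 := he 0
  have h1 := he 1
  have h2 := he 2
  simp only [Fin.sum_univ_three] at h0 h1 h2
  have yyy := Subalgebra.mul_mem (slB t (Dp L m)) (Subalgebra.mul_mem _ (Subalgebra.pow_mem _ (y 0) (e (0, 0)))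
    (Subalgebra.pow_mem _ (y 1) (e (1, 1)))) (Subalgebra.pow_mem _ (y 2) (e (2, 2)))
  rcases le_total (e (1, 0)) (e (0, 1)) with hl | hl
  · obtain ⟨k, hk⟩ := Nat.exists_eq_add_of_le hl
    have hk1 : e (1, 2) = e (2, 1) + k := by omega
    have hk2 : e (2, 0) = e (0, 2) + k := by omega
    have h := Subalgebra.mul_mem _ (Subalgebra.mul_mem _ yyy (Subalgebra.mul_mem _ (Subalgebra.mul_mem _
      (Subalgebra.pow_mem _ p (e (1, 0))) (Subalgebra.pow_mem _ q (e (2, 1))))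
      (Subalgebra.pow_mem _ r (e (0, 2))))) (Subalgebra.pow_mem _ hs k)
    convert h using 1
    funext z
    simp only [Fintype.prod_prod_type, Fin.prod_univ_three, Pi.mul_apply, Pi.pow_apply, hk, hk1, hk2,
      pow_add, mul_pow]
    ring
  · obtain ⟨k, hk⟩ := Nat.exists_eq_add_of_le hl
    have hk1 : e (2, 1) = e (1, 2) + k := by omega
    have hk2 : e (0, 2) = e (2, 0) + k := by omega
    have h := Subalgebra.mul_mem _ (Subalgebra.mul_mem _ yyy (Subalgebra.mul_mem _ (Subalgebra.mul_mem _
      (Subalgebra.pow_mem _ p (e (0, 1))) (Subalgebra.pow_mem _ q (e (1, 2))))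
      (Subalgebra.pow_mem _ r (e (2, 0))))) (Subalgebra.pow_mem _ hs' k)
    convert h using 1
    funext z
    simp only [Fintype.prod_prod_type, Fin.prod_univ_three, Pi.mul_apply, Pi.pow_apply, hk, hk1, hk2,
      pow_add, mul_pow]
    ring
end gens

variable (L) in
def tu3 : TF L 3 11 := fun A B => Fin.cons (uf3 A B) (tf3 A B)

lemma tu3_bal (e : Fin 3 × Fin 3 → ℕ) (he : ∀ k, ∑ j, e (k, j) = ∑ i, e (i, k)) :
    (fun z : ZZ L => ∏ ij, z.2 ij.1 ij.2 ^ e ij) ∈ slB (tu3 L) (Dp L 11) := by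
  have hι : ∀ A B i, tu3 L A B (Fin.succ i) = tf3 A B i := fun A B i => rfl
  have σ := slB3_sig (tu3 L) Fin.succ hι
  have hd : (fun z : ZZ L => z.2 0 1 * z.2 1 2 * z.2 2 0 - z.2 0 2 * z.2 2 1 * z.2 1 0)
      ∈ slB (tu3 L) (Dp L 11) := by
    refine ⟨1, C (C (1 / 3) * X 0), fun v y => ?_⟩
    have : tu3 L (diagonal v) y 0 = uf3 (diagonal v) y := rfl
    rw [Dp_eval]
    simp only [ev2, coe_eval₂Hom, eval₂_C, map_mul, eval_C, eval_X, this, uf3_slice]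
    ring
  refine slB3_bal (tu3 L) Fin.succ hι ?_ ?_ e he
  · convert Subalgebra.smul_mem _ (Subalgebra.add_mem _ σ hd) (1 / 2 : L) using 1
    funext z; simp; ring
  · convert Subalgebra.smul_mem _ (Subalgebra.sub_mem _ σ hd) (1 / 2 : L) using 1
    funext z; simp; ring

lemma U3_inv : IsMatInvariant (U3 L) := by
  intro a A B
  rw [eval_U3, eval_U3]
  exact uf3_conj a.inv_val A B

variable [IsAlgClosed L]

lemma uu_rel : ∃ (M : ℕ) (Q : MvPolynomial (Fin 10) L), ∀ A B : Matrix (Fin 3) (Fin 3) L,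
    eval (tf3 A B) (DS3 L) ^ M * uf3 A B ^ 2 = eval (tf3 A B) Q := by
  have hinv : IsMatInvariant (U3 L ^ 2) := by
    intro a A B
    rw [map_pow, map_pow, U3_inv a A B]
  obtain ⟨M, Q, h⟩ := slice3 (tf3 (R := L)) (fun g h hg A B => tf3_conj hg A B) id (fun _ _ _ => rfl)
    hinv (by
      convert slB3_uu (tf3 (R := L)) id (fun _ _ _ => rfl) using 1
      funext z
      rw [map_pow, eval_U3])
  exact ⟨M, Q, fun A B => by rw [← h, map_pow, eval_U3]⟩

lemma disc_f {f : MvPolynomial (MatVar 3) L} (hf : IsMatInvariant f) :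
    ∃ (M : ℕ) (α β : MvPolynomial (Fin 10) L), ∀ A B,
      eval (tf3 A B) (DS3 L) ^ M * eval (pairSub A B) f =
        eval (tf3 A B) α + eval (tf3 A B) β * uf3 A B := by
  obtain ⟨M, H, hH⟩ := slice3 (tu3 L) (fun g h hg A B => by
      simp only [tu3, tf3_conj hg, uf3_conj hg]) Fin.succ (fun _ _ _ => rfl) hf
    (slB_mem _ _ hf tu3_bal)
  obtain ⟨M0, Q, hQ⟩ := uu_rel (L := L)
  have red : ∀ G : Polynomial (MvPolynomial (Fin 10) L), ∃ (N : ℕ) (α β : MvPolynomial (Fin 10) L),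
      ∀ A B, eval (tf3 A B) (DS3 L) ^ N * Polynomial.eval (uf3 A B) (G.map (eval (tf3 A B))) =
        eval (tf3 A B) α + eval (tf3 A B) β * uf3 A B := by
    intro G
    induction G using Polynomial.induction_on' with
    | add p q hp hq =>
      obtain ⟨N, α, β, h⟩ := hp
      obtain ⟨N', α', β', h'⟩ := hq
      refine ⟨N + N', DS3 L ^ N' * α + DS3 L ^ N * α', DS3 L ^ N' * β + DS3 L ^ N * β', fun A B => ?_⟩
      rw [Polynomial.map_add, Polynomial.eval_add]
      simp only [map_add, map_mul, map_pow]
      linear_combination (eval (tf3 A B) (DS3 L)) ^ N' * h A B + (eval (tf3 A B) (DS3 L)) ^ N * h' A B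
    | monomial k c =>
      induction k with
      | zero => exact ⟨0, c, 0, fun A B => by simp⟩
      | succ k ih =>
        obtain ⟨N, α, β, h⟩ := ih
        refine ⟨N + M0, β * Q, DS3 L ^ M0 * α, fun A B => ?_⟩
        have h1 := h A B
        have h2 := hQ A B
        rw [Polynomial.map_monomial, Polynomial.eval_monomial] at h1 ⊢
        simp only [map_mul, map_pow]
        rw [← h2]
        linear_combination (eval (tf3 A B) (DS3 L)) ^ M0 * uf3 A B * h1
  obtain ⟨N, α, β, h⟩ := red (finSuccEquiv L 10 H)
  refine ⟨N + M, α, β, fun A B => ?_⟩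
  rw [← h, ← eval_eq_eval_mv_eval', pow_add, mul_assoc, hH A B]
  rfl
end PE7

section PE8
variable {L : Type*} [Field L] [CharZero L]

def ptA (a b : L) : Matrix (Fin 3) (Fin 3) L := !![a, 1, 0; 0, a, 0; 0, 0, b]
def ptB (α β γ P Q e r : L) : Matrix (Fin 3) (Fin 3) L := !![α, e, Q - P * r; β, 0, P; 1, r, γ]

lemma pt_tf3 (a b α β γ P Q e r : L) : tf3 (ptA a b) (ptB α β γ P Q e r) =
    ![2 * a ^ 3 + b ^ 3, 2 * a + b, 2 * a ^ 2 + b ^ 2, α + γ, a * α + β + b * γ,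
      a ^ 2 * α + 2 * a * β + b ^ 2 * γ, α ^ 2 + 2 * β * e + 2 * Q + γ ^ 2,
      a * (α ^ 2 + 2 * β * e + Q) + (α * β + P) + b * (Q + γ ^ 2),
      a ^ 2 * (α ^ 2 + 2 * β * e + Q) + 2 * a * (α * β + P) + b ^ 2 * (Q + γ ^ 2),
      α ^ 3 + 3 * α * β * e + 3 * ((α + β * r) * (Q - P * r) + e * P) + 3 * γ * Q + γ ^ 3] := by
  funext i
  fin_cases i <;>
    simp [tf3, ptA, ptB, Matrix.trace_fin_three, Matrix.mul_apply, Fin.sum_univ_three] <;> ring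

lemma pt_uf3 (a b α β γ P Q e r : L) : uf3 (ptA a b) (ptB α β γ P Q e r) =
    3 * (a - b) ^ 2 * (β * (2 * P * r - Q) + α * P) := by
  simp [uf3, ptA, ptB, Matrix.trace_fin_three, Matrix.mul_apply, Fin.sum_univ_three]
  ring

variable [IsAlgClosed L]
lemma pt_exists (a b : L) (hab : a - b ≠ 0) (v : Fin 10 → L) (h0 : v 0 = 2 * a ^ 3 + b ^ 3)
    (h1 : v 1 = 2 * a + b) (h2 : v 2 = 2 * a ^ 2 + b ^ 2)
    (α β γ P Q : L) (hβ : (a - b) * β = v 5 - (a + b) * v 4 + a * b * v 3)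
    (hγ : (a - b) ^ 2 * γ = v 5 - 2 * a * v 4 + a ^ 2 * v 3) (hα : α = v 3 - γ)
    (hP : (a - b) * (P + α * β) = v 8 - (a + b) * v 7 + a * b * v 6)
    (hQ : (a - b) ^ 2 * (Q + γ ^ 2) = v 8 - 2 * a * v 7 + a ^ 2 * v 6)
    (hb : β ≠ 0) (hp : P ≠ 0) : ∃ D0 : L, ∀ w : L, D0 - 4 / 3 * (β * P) * w ≠ 0 →
      ∃ A B, tf3 A B = Function.update v 9 w ∧ uf3 A B ≠ 0 := by
  let e := (v 6 - 2 * Q - γ ^ 2 - α ^ 2) / (2 * β)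
  have he : 2 * β * e = v 6 - 2 * Q - γ ^ 2 - α ^ 2 := by simp only [e]; field_simp
  refine ⟨(β * Q - α * P) ^ 2 + 4 * β * P * (α * Q + e * P
    + (α ^ 3 + 3 * α * β * e + 3 * γ * Q + γ ^ 3) / 3), fun w hw => ?_⟩
  obtain ⟨d, hd⟩ := IsAlgClosed.exists_pow_nat_eq ((β * Q - α * P) ^ 2 + 4 * β * P * (α * Q + e * P
    + (α ^ 3 + 3 * α * β * e + 3 * γ * Q + γ ^ 3) / 3) - 4 / 3 * (β * P) * w) (n := 2) (by norm_num)
  have hd0 : d ≠ 0 := by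
    rintro rfl
    apply hw
    rw [← hd]; simp
  let r := (β * Q - α * P + d) / (2 * β * P)
  have hr : 2 * β * P * r = β * Q - α * P + d := by simp only [r]; field_simp
  have v4 : v 4 = a * α + β + b * γ := by
    apply mul_left_cancel₀ hab
    rw [hα]
    linear_combination -hβ + hγ
  have v5 : v 5 = a ^ 2 * α + 2 * a * β + b ^ 2 * γ := by
    have : v 3 = α + γ := by rw [hα]; ring
    rw [v4, this] at hβ
    linear_combination -hβ
  have v7 : v 7 = a * (v 6 - Q - γ ^ 2) + (α * β + P) + b * (Q + γ ^ 2) := by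
    apply mul_left_cancel₀ hab
    linear_combination -hP + hQ
  have v8 : v 8 = a ^ 2 * (v 6 - Q - γ ^ 2) + 2 * a * (α * β + P) + b ^ 2 * (Q + γ ^ 2) := by
    rw [v7] at hP
    linear_combination -hP
  have hw9 : w = α ^ 3 + 3 * α * β * e + 3 * ((α + β * r) * (Q - P * r) + e * P)
      + 3 * γ * Q + γ ^ 3 := by
    have hd2 : d = 2 * β * P * r - (β * Q - α * P) := by rw [hr]; ring
    rw [hd2] at hd
    have : (4 / 3 * β * P) ≠ 0 := by
      refine mul_ne_zero (mul_ne_zero (by norm_num) hb) hp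
    apply mul_left_cancel₀ this
    clear_value e r
    linear_combination hd
  refine ⟨ptA a b, ptB α β γ P Q e r, ?_, ?_⟩
  · rw [pt_tf3]
    funext i
    fin_cases i
    · exact h0.symm
    · exact h1.symm
    · exact h2.symm
    · change α + γ = v 3
      rw [hα]; ring
    · exact v4.symm
    · exact v5.symm
    · change _ = v 6
      simp
      linear_combination he
    · change a * (α ^ 2 + 2 * β * e + Q) + (α * β + P) + b * (Q + γ ^ 2) = v 7
      rw [v7]
      linear_combination a * he
    · change a ^ 2 * (α ^ 2 + 2 * β * e + Q) + 2 * a * (α * β + P) + b ^ 2 * (Q + γ ^ 2) = v 8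
      rw [v8]
      linear_combination a ^ 2 * he
    · change _ = w
      rw [hw9]
      simp
  · rw [pt_uf3]
    have : β * (2 * P * r - Q) + α * P = d := by linear_combination hr
    rw [this]
    exact mul_ne_zero (mul_ne_zero (by norm_num) (pow_ne_zero _ hab)) hd0

lemma van1 (g : MvPolynomial (Fin 10) L)
    (h : ∀ A B, eval (tf3 A B) (DS3 L) = 0 → eval (tf3 A B) g * uf3 A B = 0)
    (a b : L) (hab : a - b ≠ 0) (v : Fin 10 → L) (h0 : v 0 = 2 * a ^ 3 + b ^ 3)
    (h1 : v 1 = 2 * a + b) (h2 : v 2 = 2 * a ^ 2 + b ^ 2)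
    (α β γ P Q : L) (hβ : (a - b) * β = v 5 - (a + b) * v 4 + a * b * v 3)
    (hγ : (a - b) ^ 2 * γ = v 5 - 2 * a * v 4 + a ^ 2 * v 3) (hα : α = v 3 - γ)
    (hP : (a - b) * (P + α * β) = v 8 - (a + b) * v 7 + a * b * v 6)
    (hQ : (a - b) ^ 2 * (Q + γ ^ 2) = v 8 - 2 * a * v 7 + a ^ 2 * v 6)
    (hb : β ≠ 0) (hp : P ≠ 0) : eval v g = 0 := by
  obtain ⟨D0, hD⟩ := pt_exists a b hab v h0 h1 h2 α β γ P Q hβ hγ hα hP hQ hb hp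
  have hF : aeval (Function.update (fun i => Polynomial.C (v i)) 9 Polynomial.X) g = 0 := by
    refine one_var_zero (Q := Polynomial.C D0 - Polynomial.C (4 / 3 * (β * P)) * Polynomial.X) ?_ ?_
    · intro hz
      have := congrArg (fun p => Polynomial.coeff p 1) hz
      simp [hb, hp] at this
    · intro s hs
      rw [line_eval]
      obtain ⟨A, B, hAB, hu⟩ := hD s (by simpa using hs)
      have e : (fun i => Polynomial.eval s
          ((Function.update (fun i => Polynomial.C (v i)) 9 Polynomial.X : Fin 10 → Polynomial L) i))
          = tf3 A B := by
        rw [hAB]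
        funext i
        by_cases hi : i = 9
        · subst hi; simp
        · simp [hi]
      rw [e]
      refine (mul_eq_zero.1 (h A B ?_)).resolve_right hu
      rw [DS3_eval0, hAB]
      have := discp_roots a a b
      rw [sub_self, zero_mul, zero_mul, zero_pow two_ne_zero] at this
      change discp (v 1) (v 2) (v 0) = 0
      rw [h0, h1, h2, ← this]
      ring_nf
  have := congrArg (Polynomial.eval (v 9)) hF
  rw [line_eval, Polynomial.eval_zero] at this
  rw [← this]
  congr 2
  funext i
  by_cases hi : i = 9
  · subst hi; simp
  · simp [hi]

lemma van2 (g : MvPolynomial (Fin 10) L)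
    (h : ∀ A B, eval (tf3 A B) (DS3 L) = 0 → eval (tf3 A B) g * uf3 A B = 0)
    (a b : L) (hab : a - b ≠ 0) (v : Fin 10 → L) (h0 : v 0 = 2 * a ^ 3 + b ^ 3)
    (h1 : v 1 = 2 * a + b) (h2 : v 2 = 2 * a ^ 2 + b ^ 2) : eval v g = 0 := by
  let l : Fin 10 → Polynomial L := fun i => Polynomial.C (v i) +
    (if i = 5 then Polynomial.X else 0) + (if i = 8 then Polynomial.X ^ 3 else 0)
  set δ := a - b with hδ
  let β : Polynomial L := Polynomial.C (δ⁻¹ * (v 5 - (a + b) * v 4 + a * b * v 3))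
    + Polynomial.C δ⁻¹ * Polynomial.X
  let γ : Polynomial L := Polynomial.C ((δ ^ 2)⁻¹ * (v 5 - 2 * a * v 4 + a ^ 2 * v 3))
    + Polynomial.C (δ ^ 2)⁻¹ * Polynomial.X
  let α : Polynomial L := Polynomial.C (v 3) - γ
  let P : Polynomial L := Polynomial.C (δ⁻¹ * (v 8 - (a + b) * v 7 + a * b * v 6))
    + Polynomial.C δ⁻¹ * Polynomial.X ^ 3 - α * β
  have hβ0 : β ≠ 0 := by
    intro hz
    have := congrArg (fun p => Polynomial.coeff p 1) hz
    simp [β, hab] at this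
  have hP0 : P ≠ 0 := by
    intro hz
    have hαβ : (α * β).natDegree ≤ 2 := by
      have e1 : α.natDegree ≤ 1 := by simp only [α, γ]; compute_degree
      have e2 : β.natDegree ≤ 1 := by simp only [β]; compute_degree
      exact Polynomial.natDegree_mul_le.trans (by omega)
    have h3 : (α * β).coeff 3 = 0 :=
      Polynomial.coeff_eq_zero_of_natDegree_lt (lt_of_le_of_lt hαβ (by norm_num))
    have := congrArg (fun p => Polynomial.coeff p 3) hz
    simp [P, hab, h3] at this
  have hF : aeval l g = 0 := by
    refine one_var_zero (Q := β * P) (mul_ne_zero hβ0 hP0) ?_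
    intro s hs
    rw [Polynomial.eval_mul] at hs
    rw [line_eval]
    have l3 : Polynomial.eval s (l 3) = v 3 := by simp [l]
    have l4 : Polynomial.eval s (l 4) = v 4 := by simp [l]
    have l5 : Polynomial.eval s (l 5) = v 5 + s := by simp [l]
    have l6 : Polynomial.eval s (l 6) = v 6 := by simp [l]
    have l7 : Polynomial.eval s (l 7) = v 7 := by simp [l]
    have l8 : Polynomial.eval s (l 8) = v 8 + s ^ 3 := by simp [l]
    refine van1 g h a b hab _ (by simp [l, h0]) (by simp [l, h1]) (by simp [l, h2])
      (α.eval s) (β.eval s) (γ.eval s) (P.eval s)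
      ((δ ^ 2)⁻¹ * (v 8 + s ^ 3 - 2 * a * v 7 + a ^ 2 * v 6) - (γ.eval s) ^ 2)
      ?_ ?_ ?_ ?_ ?_ (left_ne_zero_of_mul hs) (right_ne_zero_of_mul hs)
    · rw [l3, l4, l5, ← hδ]
      simp [β]
      field_simp
      ring
    · rw [l3, l4, l5, ← hδ]
      simp [γ]
      field_simp
      ring
    · rw [l3]
      simp [α]
    · rw [l6, l7, l8, ← hδ]
      simp [P]
      field_simp
      ring
    · rw [l6, l7, l8, ← hδ]
      field_simp
      ring
  have := congrArg (Polynomial.eval 0) hF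
  rw [line_eval, Polynomial.eval_zero] at this
  rw [← this]
  congr 2
  funext i
  simp only [l]
  split_ifs <;> simp

lemma key3 (g : MvPolynomial (Fin 10) L)
    (h : ∀ A B, eval (tf3 A B) (DS3 L) = 0 → eval (tf3 A B) g * uf3 A B = 0) :
    ∃ h, g = DS3 L * h := by
  have hdeg : (Polynomial.C (C (4 / 9) * X 0 ^ 3 - C 2 * X 0 * X 1) * Polynomial.X +
      Polynomial.C (C (1 / 18) * X 0 ^ 6 - C (1 / 2) * X 0 ^ 4 * X 1 + C (7 / 6) * X 0 ^ 2 * X 1 ^ 2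
        - C (1 / 6) * X 1 ^ 3) : Polynomial (MvPolynomial (Fin 9) L)).degree < 2 := by
    refine lt_of_le_of_lt (b := 1) ?_ (by norm_num)
    compute_degree
  refine divLemma (DS3 L) (-3) (by norm_num) (Polynomial.X ^ 2 +
    (Polynomial.C (C (4 / 9) * X 0 ^ 3 - C 2 * X 0 * X 1) * Polynomial.X +
      Polynomial.C (C (1 / 18) * X 0 ^ 6 - C (1 / 2) * X 0 ^ 4 * X 1 + C (7 / 6) * X 0 ^ 2 * X 1 ^ 2
        - C (1 / 6) * X 1 ^ 3)))
    (Polynomial.monic_X_pow_add hdeg) ?_ (C 3 * X 1 - X 0 ^ 2) ?_ g ?_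
  · have e1 : finSuccEquiv L 9 (X 1) = Polynomial.C (X 0) := finSuccEquiv_X_succ (j := (0 : Fin 9))
    have e2 : finSuccEquiv L 9 (X 2) = Polynomial.C (X 1) := finSuccEquiv_X_succ (j := (1 : Fin 9))
    have ec : ∀ c : L, finSuccEquiv L 9 (C c) = Polynomial.C (C c) := by
      intro c
      rw [← algebraMap_eq, AlgEquiv.commutes]; rfl
    have c1 : (C (-(4 / 3)) : MvPolynomial (Fin 9) L) = C (-3) * C (4 / 9) := by
      rw [← C_mul]; norm_num
    have c2 : (C 6 : MvPolynomial (Fin 9) L) = - (C (-3) * C 2) := by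
      rw [← C_mul, ← C_neg]; norm_num
    have c3 : (C (-(1 / 6)) : MvPolynomial (Fin 9) L) = C (-3) * C (1 / 18) := by
      rw [← C_mul]; norm_num
    have c4 : (C (3 / 2) : MvPolynomial (Fin 9) L) = - (C (-3) * C (1 / 2)) := by
      rw [← C_mul, ← C_neg]; norm_num
    have c5 : (C (7 / 2) : MvPolynomial (Fin 9) L) = - (C (-3) * C (7 / 6)) := by
      rw [← C_mul, ← C_neg]; norm_num
    have c6 : (C (1 / 2) : MvPolynomial (Fin 9) L) = - (C (-3) * C (1 / 6)) := by
      rw [← C_mul, ← C_neg]; norm_num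
    simp only [DS3, map_add, map_sub, map_mul, map_pow, finSuccEquiv_X_zero, e1, e2, ec]
    rw [c1, c2, c3, c4, c5, c6]
    simp only [map_neg, map_mul]
    ring
  · intro h0
    have := congrArg (eval ![0, 1, 0, 0, 0, 0, 0, 0, 0]) h0
    simp at this
  · intro s hs
    have hs2 : 3 * s 1 - s 0 ^ 2 ≠ 0 := by simpa using hs
    obtain ⟨δ, hδ⟩ := IsAlgClosed.exists_pow_nat_eq ((3 * s 1 - s 0 ^ 2) / 2) (n := 2) (by norm_num)
    have hδ0 : δ ≠ 0 := by
      rintro rfl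
      apply hs2
      linear_combination -2 * hδ
    have main : ∀ d : L, d ^ 2 = (3 * s 1 - s 0 ^ 2) / 2 → d ≠ 0 →
        ∀ z, z = 2 * ((s 0 + d) / 3) ^ 3 + ((s 0 - 2 * d) / 3) ^ 3 →
        eval (Fin.cons z s) (DS3 L) = 0 ∧ eval (Fin.cons z s) g = 0 := by
      intro d hd hd0 z hz
      have e1 : (Fin.cons z s : Fin 10 → L) 1 = 2 * ((s 0 + d) / 3) + ((s 0 - 2 * d) / 3) := by
        change s 0 = _
        ring
      have e2 : (Fin.cons z s : Fin 10 → L) 2 = 2 * ((s 0 + d) / 3) ^ 2 + ((s 0 - 2 * d) / 3) ^ 2 := by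
        change s 1 = _
        linear_combination (-2 / 3) * hd
      constructor
      · rw [DS3_eval0, e1, e2]
        have := discp_roots ((s 0 + d) / 3) ((s 0 + d) / 3) ((s 0 - 2 * d) / 3)
        rw [sub_self, zero_mul, zero_mul, zero_pow two_ne_zero] at this
        rw [← this]
        change discp _ _ z = _
        rw [hz]
        congr 1 <;> ring
      · exact van2 g h ((s 0 + d) / 3) ((s 0 - 2 * d) / 3) (by ring_nf; exact hd0) _ hz e1 e2
    classical
    refine ⟨{2 * ((s 0 + δ) / 3) ^ 3 + ((s 0 - 2 * δ) / 3) ^ 3,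
      2 * ((s 0 + -δ) / 3) ^ 3 + ((s 0 - 2 * -δ) / 3) ^ 3}, ?_, ?_⟩
    · rw [Finset.card_pair]
      · compute_degree!
      · intro he
        have : δ ^ 3 = 0 := by linear_combination (-9 / 4) * he
        exact hδ0 (pow_eq_zero_iff (by norm_num) |>.1 this)
    · intro z hz
      rw [Finset.mem_insert, Finset.mem_singleton] at hz
      rcases hz with hz | hz
      · exact main δ hδ hδ0 z hz
      · exact main (-δ) (by rw [← hδ]; ring) (neg_ne_zero.2 hδ0) z hz
end PE8

section PE9
lemma tf3_tr {R : Type*} [CommRing R] (A B : Matrix (Fin 3) (Fin 3) R) : tf3 Aᵀ Bᵀ = tf3 A B := by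
  have e1 : (A * A * B).trace = (Aᵀ * Aᵀ * Bᵀ).trace := by
    rw [← transpose_mul, ← transpose_mul, trace_transpose, Matrix.trace_mul_comm]
  have e2 : (A * (B * B)).trace = (Aᵀ * (Bᵀ * Bᵀ)).trace := by
    rw [← transpose_mul, ← transpose_mul, trace_transpose, Matrix.trace_mul_comm]
  have e3 : (A * B).trace = (Aᵀ * Bᵀ).trace := by
    rw [← transpose_mul, trace_transpose, Matrix.trace_mul_comm]
  have e4 : (A * A * (B * B)).trace = (Aᵀ * Aᵀ * (Bᵀ * Bᵀ)).trace := by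
    rw [← transpose_mul, ← transpose_mul, ← transpose_mul, trace_transpose, Matrix.trace_mul_comm]
  have e5 : ∀ C : Matrix (Fin 3) (Fin 3) R, (Cᵀ * Cᵀ * Cᵀ).trace = (C * C * C).trace := by
    intro C
    rw [← transpose_mul, ← transpose_mul, trace_transpose, mul_assoc]
  simp only [tf3, ← e1, ← e2, ← e3, ← e4, e5, trace_transpose]
  rw [← transpose_mul, ← transpose_mul, trace_transpose, trace_transpose]
lemma uf3_tr {R : Type*} [CommRing R] (A B : Matrix (Fin 3) (Fin 3) R) :
    uf3 Aᵀ Bᵀ = - uf3 A B := by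
  have : Aᵀ * Bᵀ - Bᵀ * Aᵀ = - (A * B - B * A)ᵀ := by
    rw [transpose_sub, transpose_mul, transpose_mul, neg_sub]
  rw [uf3, uf3, this, neg_mul_neg, mul_neg, ← transpose_mul, ← transpose_mul, trace_neg,
    trace_transpose, mul_assoc]

variable {L : Type*} [Field L] [CharZero L]
lemma tau_split (α β : MvPolynomial (Fin 10) L) (A B : Matrix (Fin 3) (Fin 3) L)
    (h : eval (tf3 A B) α + eval (tf3 A B) β * uf3 A B = 0)
    (h' : eval (tf3 Aᵀ Bᵀ) α + eval (tf3 Aᵀ Bᵀ) β * uf3 Aᵀ Bᵀ = 0) :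
    eval (tf3 A B) α = 0 ∧ eval (tf3 A B) β * uf3 A B = 0 := by
  rw [tf3_tr, uf3_tr] at h'
  constructor
  · linear_combination (h + h') / 2
  · linear_combination (h - h') / 2

variable [IsAlgClosed L]
lemma indep3u (g : MvPolynomial (Fin 10) L)
    (h : ∀ A B, eval (tf3 A B) g * uf3 A B = 0) : g = 0 := by
  refine infdiv_zero (DS3 L) 0 ![1, 0, 0, 0, 0, 0, 0, 0, 0, 0] (by simp [DS3]) (by simp [DS3])
    (fun g => ∀ A B, eval (tf3 A B) g * uf3 A B = 0) ?_ g h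
  intro g hg
  obtain ⟨h, rfl⟩ := key3 g fun A B _ => hg A B
  refine ⟨h, rfl, fun A B => ?_⟩
  rw [← eval_T3, ← eval_U3, ← map_mul]
  refine DS3_cancel (fun A B => ?_) A B
  have := hg A B
  rw [map_mul] at this
  rw [map_mul, eval_T3, eval_U3, ← mul_assoc]; exact this

lemma indep3 (α β : MvPolynomial (Fin 10) L)
    (h : ∀ A B, eval (tf3 A B) α + eval (tf3 A B) β * uf3 A B = 0) : α = 0 ∧ β = 0 := by
  have := fun A B => tau_split α β A B (h A B) (h _ _)
  exact ⟨indep3u α fun A B => by rw [(this A B).1, zero_mul], indep3u β fun A B => (this A B).2⟩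

theorem struct3 {f : MvPolynomial (MatVar 3) L} (hf : IsMatInvariant f) :
    ∃ α β : MvPolynomial (Fin 10) L, ∀ A B, eval (pairSub A B) f =
      eval (tf3 A B) α + eval (tf3 A B) β * uf3 A B := by
  obtain ⟨M, α, β, hH⟩ := disc_f hf
  induction M generalizing α β with
  | zero => exact ⟨α, β, fun A B => by simpa using hH A B⟩
  | succ M ih =>
    have hs : ∀ A B, eval (tf3 A B) (DS3 L) = 0 →
        eval (tf3 A B) α = 0 ∧ eval (tf3 A B) β * uf3 A B = 0 := by
      intro A B h0
      refine tau_split α β A B ?_ ?_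
      · rw [← hH, h0]; simp
      · rw [← hH, tf3_tr, h0]; simp
    obtain ⟨α', rfl⟩ := key3 α fun A B h0 => by rw [(hs A B h0).1, zero_mul]
    obtain ⟨β', rfl⟩ := key3 β fun A B h0 => (hs A B h0).2
    refine ih α' β' fun A B => ?_
    have := DS3_cancel (f := aeval (T3 L) (DS3 L) ^ M * f - (aeval (T3 L) α' + aeval (T3 L) β' * U3 L))
      (fun A B => by
      have := hH A B
      rw [map_sub, map_add, map_mul, map_mul, map_pow, eval_T3, eval_T3, eval_T3, eval_U3]
      rw [map_mul, map_mul] at this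
      linear_combination this) A B
    rw [map_sub, map_add, map_mul, map_mul, map_pow, eval_T3, eval_T3, eval_T3, eval_U3,
      sub_eq_zero] at this
    exact this
end PE9

section PE10
variable {K L : Type*} [Field K] [Field L] [Algebra K L]

lemma desc {ι σ : Type*} (S : Finset ι) (c : ι → L) (m : ι → MvPolynomial σ K)
    (f : MvPolynomial σ K)
    (h : map (algebraMap K L) f = ∑ i ∈ S, C (c i) * map (algebraMap K L) (m i)) :
    ∃ c' : ι → K, f = ∑ i ∈ S, C (c' i) * m i := by
  obtain ⟨p, hp⟩ := LinearMap.exists_leftInverse_of_injective (Algebra.linearMap K L)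
    (LinearMap.ker_eq_bot.2 (algebraMap K L).injective)
  have hp1 : ∀ x : K, p (algebraMap K L x) = x := fun x => LinearMap.congr_fun hp x
  refine ⟨fun i => p (c i), ?_⟩
  ext d
  have := congrArg (fun q => p (coeff d q)) h
  simp only [coeff_map, hp1, coeff_sum, coeff_C_mul, map_sum] at this
  rw [this, coeff_sum]
  refine Finset.sum_congr rfl fun i _ => ?_
  rw [coeff_C_mul, mul_comm, ← Algebra.smul_def, map_smul, smul_eq_mul, mul_comm]

lemma aeval_expd {ι σ R : Type*} [CommRing R] (T : ι → MvPolynomial σ R) (α : MvPolynomial ι R) :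
    aeval T α = ∑ e ∈ α.support, C (coeff e α) * ∏ i ∈ e.support, T i ^ e i := by
  rw [aeval_def, eval₂_eq]; rfl

lemma aeval_mono {ι σ R : Type*} [CommRing R] (T : ι → MvPolynomial σ R) (S : Finset (ι →₀ ℕ))
    (c : (ι →₀ ℕ) → R) : aeval T (∑ e ∈ S, monomial e (c e)) =
      ∑ e ∈ S, C (c e) * ∏ i ∈ e.support, T i ^ e i := by
  rw [map_sum]
  refine Finset.sum_congr rfl fun e _ => ?_
  rw [aeval_monomial]; rfl

lemma gX_ext (n : ℕ) : (gX K n).map (map (algebraMap K L)) = gX L n := by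
  ext1 i j; simp [gX]
lemma gY_ext (n : ℕ) : (gY K n).map (map (algebraMap K L)) = gY L n := by
  ext1 i j; simp [gY]
lemma T2_ext (i) : map (algebraMap K L) (T2 K i) = T2 L i := by
  rw [T2, ← tf2_map, gX_ext, gY_ext, T2]
lemma T3_ext (i) : map (algebraMap K L) (T3 K i) = T3 L i := by
  rw [T3, ← tf3_map, gX_ext, gY_ext, T3]
lemma U3_ext : map (algebraMap K L) (U3 K) = U3 L := by
  rw [U3, ← uf3_map, gX_ext, gY_ext, U3]

lemma desc2 (f : MvPolynomial (MatVar 2) K) (α : MvPolynomial (Fin 5) L)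
    (h : map (algebraMap K L) f = aeval (T2 L) α) :
    ∃ α' : MvPolynomial (Fin 5) K, f = aeval (T2 K) α' := by
  obtain ⟨c, hc⟩ := desc (L := L) α.support (fun e => coeff e α)
    (fun e => ∏ i ∈ e.support, T2 K i ^ e i) f (by
      rw [h, aeval_expd]
      simp only [map_prod, map_pow, T2_ext])
  exact ⟨_, hc.trans (aeval_mono _ _ _).symm⟩

lemma desc3 (f : MvPolynomial (MatVar 3) K) (α β : MvPolynomial (Fin 10) L)
    (h : map (algebraMap K L) f = aeval (T3 L) α + aeval (T3 L) β * U3 L) :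
    ∃ α' β' : MvPolynomial (Fin 10) K, f = aeval (T3 K) α' + aeval (T3 K) β' * U3 K := by
  obtain ⟨c, hc⟩ := desc (L := L) (α.support.disjSum β.support)
    (Sum.elim (fun e => coeff e α) (fun e => coeff e β))
    (Sum.elim (fun e => ∏ i ∈ e.support, T3 K i ^ e i)
      (fun e => (∏ i ∈ e.support, T3 K i ^ e i) * U3 K)) f (by
      rw [h, aeval_expd, aeval_expd, Finset.sum_disjSum, Finset.sum_mul]
      simp only [Sum.elim_inl, Sum.elim_inr, map_mul, map_prod, map_pow, T3_ext, U3_ext, mul_assoc])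
  refine ⟨∑ e ∈ α.support, monomial e (c (Sum.inl e)), ∑ e ∈ β.support, monomial e (c (Sum.inr e)), ?_⟩
  rw [hc, Finset.sum_disjSum, aeval_mono _ _ (fun e => c (Sum.inl e)),
    aeval_mono _ _ (fun e => c (Sum.inr e)), Finset.sum_mul]
  simp only [Sum.elim_inl, Sum.elim_inr, mul_assoc]

lemma ext_eval {ι : Type*} (v : ι → L) (α : MvPolynomial ι K) :
    eval v (map (algebraMap K L) α) = aeval v α := by
  rw [eval_map, aeval_def]

lemma T2_invar (α : MvPolynomial (Fin 5) K) : IsMatInvariant (aeval (T2 K) α) := by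
  intro a A B
  have ha : ((a⁻¹ : GL (Fin 2) K) : Matrix (Fin 2) (Fin 2) K) * (a : Matrix (Fin 2) (Fin 2) K) = 1 := by
    rw [← Units.val_mul, inv_mul_cancel, Units.val_one]
  have := tf2_conj ha A B
  have e : ∀ A B : Matrix (Fin 2) (Fin 2) K, eval (pairSub A B) (aeval (T2 K) α) =
    eval (tf2 A B) α := fun A B => aeval_T2 A B α
  rw [e, e, this]
lemma T3_invar (α β : MvPolynomial (Fin 10) K) :
    IsMatInvariant (aeval (T3 K) α + aeval (T3 K) β * U3 K) := by
  intro a A B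
  have ha : ((a⁻¹ : GL (Fin 3) K) : Matrix (Fin 3) (Fin 3) K) * (a : Matrix (Fin 3) (Fin 3) K) = 1 := by
    rw [← Units.val_mul, inv_mul_cancel, Units.val_one]
  have := tf3_conj ha A B
  have hu := uf3_conj ha A B
  have e : ∀ (α) (A B : Matrix (Fin 3) (Fin 3) K), eval (pairSub A B) (aeval (T3 K) α) =
    eval (tf3 A B) α := fun α A B => aeval_T3 A B α
  have e2 : ∀ (A B : Matrix (Fin 3) (Fin 3) K), eval (pairSub A B) (U3 K) = uf3 A B :=
    fun A B => U3_aeval A B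
  simp only [map_add, map_mul]
  rw [e, e, e, e, e2, e2, this, hu]
end PE10

theorem poincare_aux2 (K : Type*) [Field K] [CharZero K] : sharpPS K 2 * (1 - pu ^ 4) ^ 2 = 1 := by
  have : CharZero (AlgebraicClosure K) := charZero_of_injective_algebraMap
    (algebraMap K (AlgebraicClosure K)).injective
  refine assemble2 (T2 K) T2_wt ?_ ?_
  · rw [injective_iff_map_eq_zero]
    intro α h
    have := indep2 (L := AlgebraicClosure K) (map (algebraMap K _) α) (by
      intro A B
      rw [ext_eval, ← aeval_T2, h, map_zero])
    exact map_injective _ (algebraMap K (AlgebraicClosure K)).injective (by rw [this, map_zero])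
  · intro f
    constructor
    · intro hf
      obtain ⟨α, h⟩ := struct2 (inv_ext (L := AlgebraicClosure K) hf)
      exact desc2 f α (pair_funext fun A B => by rw [h, eval_T2])
    · rintro ⟨α, rfl⟩
      exact T2_invar α

theorem poincare_aux3 (K : Type*) [Field K] [CharZero K] :
    sharpPS K 3 * ((1 - pu ^ 4) ^ 3 * (1 - pu ^ 6) ^ 3 * (1 - pu ^ 8)) =
      1 + 3 * pu ^ 8 + pu ^ 10 + 3 * pu ^ 12 + pu ^ 20 := by
  have : CharZero (AlgebraicClosure K) := charZero_of_injective_algebraMap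
    (algebraMap K (AlgebraicClosure K)).injective
  refine assemble3 (T3 K) (U3 K) T3_wt U3_wt ?_ ?_
  · intro α β h
    have := indep3 (L := AlgebraicClosure K) (map (algebraMap K _) α) (map (algebraMap K _) β) (by
      intro A B
      rw [ext_eval, ext_eval, ← aeval_T3, ← aeval_T3, ← U3_aeval (K := K), ← map_mul, ← map_add, h,
        map_zero])
    exact ⟨map_injective _ (algebraMap K (AlgebraicClosure K)).injective (by rw [this.1, map_zero]),
      map_injective _ (algebraMap K (AlgebraicClosure K)).injective (by rw [this.2, map_zero])⟩
  · intro f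
    constructor
    · intro hf
      obtain ⟨α, β, h⟩ := struct3 (inv_ext (L := AlgebraicClosure K) hf)
      exact desc3 f α β (pair_funext fun A B => by
        rw [h, map_add, map_mul, eval_T3, eval_T3, eval_U3])
    · rintro ⟨α, β, rfl⟩
      exact T3_invar α β

/-- The Poincaré series of the algebras of `GL_n × SL₂`-invariant polynomial functions on
`M_n ⊗ K²` for `n = 2, 3` are `P(C^#_{2,2}; t) = 1/(1−t⁴)²` and
`P(C^#_{3,2}; t) = (1 + 3t⁸ + t¹⁰ + 3t¹² + t²⁰) / ((1−t⁴)³(1−t⁶)³(1−t⁸))`. -/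
theorem poincare_Csharp_2_3 (K : Type*) [Field K] [CharZero K] :
    sharpPS K 2 * (1 - pu ^ 4) ^ 2 = 1 ∧
    sharpPS K 3 * ((1 - pu ^ 4) ^ 3 * (1 - pu ^ 6) ^ 3 * (1 - pu ^ 8)) =
      1 + 3 * pu ^ 8 + pu ^ 10 + 3 * pu ^ 12 + pu ^ 20 := by
  exact ⟨poincare_aux2 K, poincare_aux3 K⟩
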